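/- arXiv:1805.12595 — 2 statements merged into one kernel-verified Lean document; each statement's English description precedes it below -/
import Mathlib

section
/- For every ε > 0, every η with 8√ε < η < 1, and every K > 2ε, there exists n₀ = n₀(ε,η,K) such that for every n ≥ n₀ and every rate R with 2ε ≤ R ≤ K for which M = 2^{nR} is an integer, there exist M unit vectors a(1), ..., a(M) in ℝ^n with the following two properties, holding for every unit vector c ∈ ℝ^n and all θ, ζ ∈ [0,1]: (i) the number of indices m̃ ∈ [1:M] with ⟨a(m̃), c⟩ ≥ θ is at most 2^{n([R + ½log₂(1−θ²)]₊ + ε)}, where [t]₊ = max{0,t}; and (ii) if θ ≥ η and θ² + ζ² > 1 + η − 2^{−2R}, then the number of indices m ∈ [1:M] for which there exists some m̃ ≠ m with |⟨a(m̃), a(m)⟩| ≥ θ and |⟨a(m̃), c⟩| ≥ ζ is at most M · 2^{−nε}. -/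
open scoped RealInnerProductSpace

noncomputable section

section

open MeasureTheory ProbabilityTheory

lemma integral_exp_mul_sq_gaussianReal {s : ℝ} (hs : s < 1) :
    ∫ x, Real.exp (s / 2 * x ^ 2) ∂(gaussianReal 0 1) = (√(1 - s))⁻¹ := by
  rw [integral_gaussianReal_eq_integral_smul one_ne_zero]
  have h (x : ℝ) : gaussianPDFReal 0 1 x • Real.exp (s / 2 * x ^ 2)
      = (√(2 * Real.pi))⁻¹ * Real.exp (-((1 - s) / 2) * x ^ 2) := by
    simp only [gaussianPDFReal, NNReal.coe_one, mul_one, sub_zero, smul_eq_mul]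
    rw [mul_assoc, ← Real.exp_add]
    ring_nf
  simp_rw [h]
  rw [integral_const_mul, integral_gaussian, ← Real.sqrt_inv, ← Real.sqrt_inv,
    ← Real.sqrt_mul (by positivity)]
  congr 1
  have : 1 - s ≠ 0 := by linarith
  field_simp

lemma integrable_exp_mul_sq_gaussianReal {s : ℝ} (hs : s < 1) :
    Integrable (fun x ↦ Real.exp (s / 2 * x ^ 2)) (gaussianReal 0 1) := by
  by_contra h
  have := integral_exp_mul_sq_gaussianReal hs
  rw [integral_undef h] at this
  have h2 : 0 < (√(1 - s))⁻¹ := by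
    have : 0 < 1 - s := by linarith
    positivity
  linarith

lemma exists_orthonormalBasis_apply_eq {n : ℕ} (i : Fin n) {c : EuclideanSpace ℝ (Fin n)}
    (hc : ‖c‖ = 1) : ∃ b : OrthonormalBasis (Fin n) ℝ (EuclideanSpace ℝ (Fin n)), b i = c := by
  have hv : Orthonormal ℝ (({i} : Set (Fin n)).domRestrict fun _ ↦ c) := by
    refine ⟨fun _ ↦ hc, fun j k hjk ↦ ?_⟩
    exact absurd (Subsingleton.elim j k) hjk
  obtain ⟨b, hb⟩ := hv.exists_orthonormalBasis_extension_of_card_eq (by simp)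
  exact ⟨b, hb i rfl⟩

/-- Chernoff bound for the standard Gaussian measure of a double cone. -/
lemma stdGaussian_cone_le {n : ℕ} (hn : 0 < n) {c : EuclideanSpace ℝ (Fin n)} (hc : ‖c‖ = 1)
    {r d : ℝ} (hr : 0 < r) (hr1 : r ≤ 1) (hd : 0 < d) (hd1 : d < 1) :
    (stdGaussian (EuclideanSpace ℝ (Fin n))).real {x | (1 - r ^ 2) * ‖x‖ ^ 2 ≤ ⟪x, c⟫ ^ 2} ≤
      (√d * r)⁻¹ * (r / √(1 - d)) ^ n := by
  obtain ⟨b, hb⟩ := exists_orthonormalBasis_apply_eq ⟨0, hn⟩ hc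
  set i₀ : Fin n := ⟨0, hn⟩
  set l : ℝ := (1 - d) / r ^ 2 with hl
  have hl0 : 0 < l := div_pos (by linarith) (by positivity)
  have hr2 : r ^ 2 ≤ 1 := by nlinarith
  have hlr : l * r ^ 2 = 1 - d := by rw [hl]; field_simp
  have hl1 : (1 - d) / r ^ 2 ≤ 1 + l * (1 - r ^ 2) := by rw [← hl]; nlinarith
  have hl2 : 1 + l * (1 - r ^ 2) ≤ 1 / r ^ 2 := by
    rw [le_div_iff₀ (by positivity)]
    nlinarith
  set s : Fin n → ℝ := fun i ↦ (if i = i₀ then l else 0) - l * (1 - r ^ 2) with hs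
  have hs1 (i : Fin n) : s i < 1 := by
    simp only [hs]
    split_ifs <;> nlinarith
  have hmeas : Measurable fun x : Fin n → ℝ ↦ ∑ i, x i • b i := by fun_prop
  have hset : MeasurableSet
      {x : EuclideanSpace ℝ (Fin n) | (1 - r ^ 2) * ‖x‖ ^ 2 ≤ ⟪x, c⟫ ^ 2} :=
    measurableSet_le (by fun_prop) (by fun_prop)
  rw [stdGaussian_eq_map_pi_orthonormalBasis b, map_measureReal_apply hmeas hset]
  have hint : Integrable (fun x : Fin n → ℝ ↦ ∏ i, Real.exp (s i / 2 * x i ^ 2))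
      (Measure.pi fun _ ↦ gaussianReal 0 1) :=
    Integrable.fintype_prod fun i ↦ integrable_exp_mul_sq_gaussianReal (hs1 i)
  have hsub : (fun x : Fin n → ℝ ↦ ∑ i, x i • b i) ⁻¹' {x | (1 - r ^ 2) * ‖x‖ ^ 2 ≤ ⟪x, c⟫ ^ 2}
      ⊆ {x | 1 ≤ ∏ i, Real.exp (s i / 2 * x i ^ 2)} := by
    intro x hx
    simp only [Set.mem_preimage, Set.mem_ofPred_eq] at hx ⊢
    have h1 : ⟪∑ i, x i • b i, c⟫ = x i₀ := by
      rw [← hb, real_inner_comm]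
      exact b.orthonormal.inner_right_fintype x i₀
    have h2 : ‖∑ i, x i • b i‖ ^ 2 = ∑ i, x i ^ 2 := by
      rw [← real_inner_self_eq_norm_sq, b.orthonormal.inner_sum]
      simp [sq]
    rw [h1, h2] at hx
    rw [← Real.exp_sum, Real.one_le_exp_iff]
    have h3 : ∑ i, s i / 2 * x i ^ 2 = l / 2 * (x i₀ ^ 2 - (1 - r ^ 2) * ∑ i, x i ^ 2) := by
      simp only [hs, sub_div, sub_mul, Finset.sum_sub_distrib, ite_div, ite_mul, zero_div, zero_mul,
        Finset.sum_ite_eq', Finset.mem_univ, if_true, ← Finset.mul_sum]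
      ring
    rw [h3]
    exact mul_nonneg (by positivity) (by linarith)
  calc _ ≤ (Measure.pi fun _ ↦ gaussianReal 0 1).real
        {x : Fin n → ℝ | 1 ≤ ∏ i, Real.exp (s i / 2 * x i ^ 2)} := measureReal_mono hsub
    _ ≤ ∫ x : Fin n → ℝ, ∏ i, Real.exp (s i / 2 * x i ^ 2)
          ∂(Measure.pi fun _ ↦ gaussianReal 0 1) := by
        simpa using mul_meas_ge_le_integral_of_nonneg
          (Filter.Eventually.of_forall fun x ↦ by positivity) hint 1
    _ = ∏ i, (√(1 - s i))⁻¹ := by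
        rw [integral_fintype_prod_eq_prod (fun i y ↦ Real.exp (s i / 2 * y ^ 2))]
        exact Finset.prod_congr rfl fun i _ ↦ integral_exp_mul_sq_gaussianReal (hs1 i)
    _ = ∏ i, ((√(1 + l * (1 - r ^ 2)))⁻¹ *
          (if i = i₀ then √(1 + l * (1 - r ^ 2)) * (√d)⁻¹ else 1)) := by
        refine Finset.prod_congr rfl fun i _ ↦ ?_
        have hp : 0 < √(1 + l * (1 - r ^ 2)) := Real.sqrt_pos.2 (by nlinarith)
        simp only [hs]
        split_ifs
        · rw [inv_mul_cancel_left₀ hp.ne']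
          congr 2
          linarith
        · simp
    _ = √(1 + l * (1 - r ^ 2)) * (√d)⁻¹ * ((√(1 + l * (1 - r ^ 2)))⁻¹) ^ n := by
        rw [Finset.prod_mul_distrib]
        simp [mul_comm]
    _ ≤ _ := by
        have h1 : √(1 + l * (1 - r ^ 2)) ≤ r⁻¹ := by
          refine Real.sqrt_le_iff.2 ⟨by positivity, ?_⟩
          simpa using hl2
        have h2 : (√(1 + l * (1 - r ^ 2)))⁻¹ ≤ r / √(1 - d) := by
          rw [← inv_div]
          refine inv_anti₀ (div_pos (Real.sqrt_pos.2 (by linarith)) hr) ?_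
          refine Real.le_sqrt_of_sq_le ?_
          rw [div_pow, Real.sq_sqrt (by linarith)]
          exact hl1
        rw [mul_inv, mul_comm (√d)⁻¹]
        gcongr

/-- A random unit vector for which the double caps have exponentially small probability. -/
lemma exists_measure_sphere_cap_le {n : ℕ} (hn : 0 < n) :
    ∃ μ : Measure (Metric.sphere (0 : EuclideanSpace ℝ (Fin n)) 1), IsProbabilityMeasure μ ∧
      ∀ c : EuclideanSpace ℝ (Fin n), ‖c‖ = 1 → ∀ t r d : ℝ, 0 ≤ t → 0 < r → r ≤ 1 →
        0 < d → d < 1 → 1 - t ^ 2 ≤ r ^ 2 →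
        μ.real {x | t ≤ |⟪(x : EuclideanSpace ℝ (Fin n)), c⟫|} ≤
          (√d * r)⁻¹ * (r / √(1 - d)) ^ n := by
  classical
  set e : EuclideanSpace ℝ (Fin n) := EuclideanSpace.single ⟨0, hn⟩ 1 with he
  set N : EuclideanSpace ℝ (Fin n) → EuclideanSpace ℝ (Fin n) :=
    fun x ↦ if x = 0 then e else ‖x‖⁻¹ • x with hN
  have hN1 (x) : N x ∈ Metric.sphere (0 : EuclideanSpace ℝ (Fin n)) 1 := by
    rw [mem_sphere_zero_iff_norm]
    simp only [hN]
    split_ifs with hx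
    · simp [he]
    · rw [norm_smul, norm_inv, norm_norm, inv_mul_cancel₀ (norm_ne_zero_iff.2 hx)]
  have hNm : Measurable N := by
    refine Measurable.ite (measurableSet_singleton 0) measurable_const ?_
    fun_prop
  have hNm' : Measurable (fun x ↦ (⟨N x, hN1 x⟩ : Metric.sphere (0 : EuclideanSpace ℝ (Fin n)) 1)) :=
    hNm.subtype_mk
  refine ⟨(stdGaussian (EuclideanSpace ℝ (Fin n))).map fun x ↦ ⟨N x, hN1 x⟩,
    Measure.isProbabilityMeasure_map hNm'.aemeasurable, ?_⟩
  intro c hc t r d ht hr hr1 hd hd1 htr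
  rw [map_measureReal_apply hNm' (measurableSet_le (by fun_prop) (by fun_prop))]
  refine (measureReal_mono ?_).trans (stdGaussian_cone_le hn hc hr hr1 hd hd1)
  intro x hx
  simp only [Set.mem_preimage, Set.mem_ofPred_eq, hN] at hx ⊢
  split_ifs at hx with h0
  · simp [h0]
  · have hx0 : 0 < ‖x‖ := norm_pos_iff.2 h0
    rw [real_inner_smul_left, abs_mul, abs_of_pos (inv_pos.2 hx0), ← div_eq_inv_mul,
      le_div_iff₀ hx0] at hx
    have h1 : (t * ‖x‖) ^ 2 ≤ ⟪x, c⟫ ^ 2 := by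
      rw [← sq_abs ⟪x, c⟫]
      gcongr
    nlinarith [sq_nonneg ‖x‖]

lemma exp_le_one_add_two_mul {y : ℝ} (h0 : 0 ≤ y) (h1 : y ≤ 1) : Real.exp y ≤ 1 + 2 * y := by
  have h := convexOn_exp.2 (Set.mem_univ 0) (Set.mem_univ 1) (sub_nonneg.2 h1) h0 (by ring)
  simp only [smul_eq_mul, mul_zero, mul_one, zero_add, Real.exp_zero] at h
  nlinarith [Real.exp_one_lt_d9]

/-- Derandomized Chernoff bound: points can be chosen one after the other so that all of finitely
many adapted sums of `[0, 1]`-valued terms stay close to the bounds on their conditional means. -/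
lemma exists_seq_forall_sum_le {Ω ι : Type*} [MeasurableSpace Ω] (μ : Measure Ω)
    [IsProbabilityMeasure μ] [Fintype ι] [Nonempty ι] (M : ℕ)
    (f : ι → ℕ → (ℕ → Ω) → Ω → ℝ) (p : ι → ℝ)
    (hloc : ∀ i k a b, (∀ j < k, a j = b j) → f i k a = f i k b)
    (hf0 : ∀ i k a x, 0 ≤ f i k a x) (hf1 : ∀ i k a x, f i k a x ≤ 1)
    (hfm : ∀ i k a, Measurable (f i k a))
    (hp : ∀ i, ∀ k < M, ∀ a, ∫ x, f i k a x ∂μ ≤ p i) :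
    ∃ a : ℕ → Ω, ∀ i, ∑ k ∈ Finset.range M, f i k a (a k) ≤
      2 * M * p i + Real.log (Fintype.card ι) := by
  classical
  set S : ι → ℕ → (ℕ → Ω) → ℝ := fun i m a ↦ ∑ k ∈ Finset.range m, f i k a (a k) with hS
  have key : ∀ m ≤ M, ∃ a : ℕ → Ω,
      ∑ i, Real.exp (S i m a - 2 * m * p i) ≤ Fintype.card ι := by
    intro m
    induction m with
    | zero =>
      intro _
      have : Nonempty Ω := nonempty_of_isProbabilityMeasure μ
      exact ⟨fun _ ↦ Classical.arbitrary Ω, by simp [hS]⟩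
    | succ m ih =>
      intro hm
      obtain ⟨a, ha⟩ := ih (by omega)
      set g : Ω → ℝ := fun x ↦ ∑ i, Real.exp (S i m a - 2 * m * p i) *
        (Real.exp (-(2 * p i)) * (1 + 2 * f i m a x)) with hg
      have hfi (i) : Integrable (f i m a) μ :=
        Integrable.of_bound (hfm i m a).aestronglyMeasurable 1
          (Filter.Eventually.of_forall fun x ↦ by
            rw [Real.norm_of_nonneg (hf0 i m a x)]; exact hf1 i m a x)
      have hgi (i) : Integrable (fun x ↦ Real.exp (S i m a - 2 * m * p i) *
          (Real.exp (-(2 * p i)) * (1 + 2 * f i m a x))) μ :=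
        (((integrable_const 1).add ((hfi i).const_mul 2)).const_mul _).const_mul _
      obtain ⟨x, hx⟩ := exists_le_integral (μ := μ) (f := g)
        (integrable_finsetSum _ fun i _ ↦ hgi i)
      have hgle : ∫ y, g y ∂μ ≤ ∑ i, Real.exp (S i m a - 2 * m * p i) := by
        simp only [hg]
        rw [integral_finsetSum _ fun i _ ↦ hgi i]
        refine Finset.sum_le_sum fun i _ ↦ ?_
        rw [integral_const_mul, integral_const_mul,
          integral_add (integrable_const 1) ((hfi i).const_mul 2), integral_const_mul]
        have h1 : 1 + 2 * ∫ y, f i m a y ∂μ ≤ Real.exp (2 * p i) := by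
          have := Real.add_one_le_exp (2 * p i)
          have := hp i m (by omega) a
          linarith
        calc _ ≤ Real.exp (S i m a - 2 * m * p i) * (Real.exp (-(2 * p i)) * Real.exp (2 * p i)) := by
              gcongr
              simpa using h1
          _ = _ := by rw [← Real.exp_add]; simp
      refine ⟨Function.update a m x, le_trans (le_trans ?_ (hx.trans hgle)) ha⟩
      simp only [hg]
      refine Finset.sum_le_sum fun i _ ↦ ?_
      have hupd : ∀ k ≤ m, f i k (Function.update a m x) = f i k a := fun k hk ↦
        hloc i k _ _ fun j hj ↦ Function.update_of_ne (by omega) _ _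
      have hSm : S i (m + 1) (Function.update a m x) = S i m a + f i m a x := by
        simp only [hS, Finset.sum_range_succ]
        rw [hupd m le_rfl, Function.update_self]
        congr 1
        refine Finset.sum_congr rfl fun k hk ↦ ?_
        have hk' := Finset.mem_range.1 hk
        rw [hupd k hk'.le, Function.update_of_ne hk'.ne]
      rw [hSm]
      calc _ = Real.exp (S i m a - 2 * m * p i) *
            (Real.exp (-(2 * p i)) * Real.exp (f i m a x)) := by
            rw [← Real.exp_add, ← Real.exp_add]
            push_cast
            ring_nf
        _ ≤ _ := by
            gcongr
            exact exp_le_one_add_two_mul (hf0 i m a x) (hf1 i m a x)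
  obtain ⟨a, ha⟩ := key M le_rfl
  refine ⟨a, fun i ↦ ?_⟩
  have h1 : Real.exp (S i M a - 2 * M * p i) ≤ Fintype.card ι :=
    (Finset.single_le_sum (f := fun i ↦ Real.exp (S i M a - 2 * M * p i))
      (fun _ _ ↦ (Real.exp_pos _).le) (Finset.mem_univ i)).trans ha
  have h2 := (Real.le_log_iff_exp_le (by positivity)).2 h1
  simp only [hS] at h2
  linarith

/-- Simultaneous control, for a well chosen sequence, of the hitting numbers of finitely many sets
and of the numbers of related pairs for finitely many relations. -/
lemma exists_seq_counts_le {Ω ι κ : Type*} [MeasurableSpace Ω] (μ : Measure Ω)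
    [IsProbabilityMeasure μ] [Fintype ι] [Fintype κ] [Nonempty ι] (M : ℕ)
    (Q : ι → Set Ω) (hQ : ∀ i, MeasurableSet (Q i))
    (P : κ → Set (Ω × Ω)) (hP : ∀ t, MeasurableSet (P t))
    {p b B : ℝ} (hb : 0 < b) (hB : 0 < B)
    (hPp : ∀ t x, μ.real {y | (x, y) ∈ P t} ≤ p) (hPb : ∀ t y, μ.real {x | (x, y) ∈ P t} ≤ b) :
    ∃ a : ℕ → Ω,
      (∀ i, ∑ k ∈ Finset.range M, (Q i).indicator 1 (a k) ≤
        2 * M * μ.real (Q i) + Real.log (Fintype.card ι + 3 * Fintype.card κ)) ∧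
      (∀ t, ∑ k ∈ Finset.range M,
          min B (∑ j ∈ Finset.range k, (P t).indicator 1 (a j, a k)) ≤
        2 * M * (M * p) + B * Real.log (Fintype.card ι + 3 * Fintype.card κ)) ∧
      (∀ t, ∑ k ∈ Finset.range M, (⋃ j ∈ Finset.range k, {x | (x, a j) ∈ P t}).indicator 1 (a k) ≤
        2 * M * (2 * M * p + b * Real.log (Fintype.card ι + 3 * Fintype.card κ)) +
          Real.log (Fintype.card ι + 3 * Fintype.card κ)) := by
  classical
  set L : ℝ := Real.log (Fintype.card ι + 3 * Fintype.card κ) with hL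
  have hm1 (t x) : MeasurableSet {y | (x, y) ∈ P t} := measurable_prodMk_left (hP t)
  have hm2 (t y) : MeasurableSet {x | (x, y) ∈ P t} := measurable_prodMk_right (hP t)
  set g : κ → Ω → ℝ := fun t y ↦ μ.real {x | (x, y) ∈ P t} with hg
  have hgm (t) : Measurable (g t) := (measurable_measure_prodMk_right (hP t)).ennreal_toReal
  have hg0 (t y) : 0 ≤ g t y := measureReal_nonneg
  have hgint (t) : ∫ y, g t y ∂μ ≤ p := by
    have h1 : ∫ y, g t y ∂μ = (μ.prod μ).real (P t) := by
      rw [measureReal_def, Measure.prod_apply_symm (hP t), ← integral_toReal]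
      · rfl
      · exact (measurable_measure_prodMk_right (hP t)).aemeasurable
      · exact Filter.Eventually.of_forall fun y ↦ measure_lt_top _ _
    have h2 : ∫ x, μ.real {y | (x, y) ∈ P t} ∂μ = (μ.prod μ).real (P t) := by
      rw [measureReal_def, Measure.prod_apply (hP t), ← integral_toReal]
      · rfl
      · exact (measurable_measure_prodMk_left (hP t)).aemeasurable
      · exact Filter.Eventually.of_forall fun y ↦ measure_lt_top _ _
    rw [h1, ← h2]
    have hi : Integrable (fun x ↦ μ.real {y | (x, y) ∈ P t}) μ :=
      Integrable.of_bound
        (measurable_measure_prodMk_left (hP t)).ennreal_toReal.aestronglyMeasurable 1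
        (Filter.Eventually.of_forall fun x ↦ by
          rw [Real.norm_of_nonneg measureReal_nonneg]; exact measureReal_le_one)
    simpa using integral_mono hi (integrable_const p) (hPp t)
  set s : ℝ := 2 * M * p + b * L with hs
  set U : κ → ℕ → (ℕ → Ω) → Set Ω := fun t k a ↦ ⋃ j ∈ Finset.range k, {x | (x, a j) ∈ P t} with hU
  have hUm (t k a) : MeasurableSet (U t k a) :=
    Finset.measurableSet_biUnion _ fun j _ ↦ hm2 t (a j)
  set f : ι ⊕ κ ⊕ κ ⊕ κ → ℕ → (ℕ → Ω) → Ω → ℝ := fun i ↦ match i with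
    | .inl i => fun _ _ ↦ (Q i).indicator 1
    | .inr (.inl t) => fun k a x ↦
        min B (∑ j ∈ Finset.range k, (P t).indicator 1 (a j, x)) / B
    | .inr (.inr (.inl t)) => fun _ _ x ↦ g t x / b
    | .inr (.inr (.inr t)) => fun k a x ↦
        if ∑ j ∈ Finset.range k, g t (a j) ≤ s then (U t k a).indicator 1 x else 0 with hf
  set q : ι ⊕ κ ⊕ κ ⊕ κ → ℝ := fun i ↦ match i with
    | .inl i => μ.real (Q i)
    | .inr (.inl _) => M * p / B
    | .inr (.inr (.inl _)) => p / b
    | .inr (.inr (.inr _)) => s with hq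
  have hpos (t : κ) : 0 ≤ p :=
    have : Nonempty Ω := nonempty_of_isProbabilityMeasure μ
    measureReal_nonneg.trans (hPp t (Classical.arbitrary Ω))
  have hL0 : 0 ≤ L := by
    have : (1 : ℝ) ≤ Fintype.card ι := by exact_mod_cast Fintype.card_pos
    exact Real.log_nonneg (by linarith [(Fintype.card κ).cast_nonneg (α := ℝ)])
  have hs0 (t : κ) : 0 ≤ s := by have := hpos t; positivity
  have hind {α : Type _} (A : Set α) (x : α) : 0 ≤ A.indicator (1 : α → ℝ) x ∧
      A.indicator (1 : α → ℝ) x ≤ 1 := by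
    by_cases h : x ∈ A <;> simp [h]
  have hindint {A : Set Ω} (hA : MeasurableSet A) : ∫ x, A.indicator (1 : Ω → ℝ) x ∂μ = μ.real A :=
    integral_indicator_one hA
  have hindi {A : Set Ω} (hA : MeasurableSet A) : Integrable (A.indicator (1 : Ω → ℝ)) μ :=
    (integrable_const (1 : ℝ)).indicator hA
  obtain ⟨a, ha⟩ := exists_seq_forall_sum_le μ M f q
    (by
      rintro (i | t | t | t) k a a' h
      · rfl
      · funext x
        simp only [hf]
        congr 2
        exact Finset.sum_congr rfl fun j hj ↦ by rw [h j (Finset.mem_range.1 hj)]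
      · rfl
      · have h1 : U t k a = U t k a' := by
          simp only [hU]
          exact Set.iUnion₂_congr fun j hj ↦ by rw [h j (Finset.mem_range.1 hj)]
        have h2 : ∑ j ∈ Finset.range k, g t (a j) = ∑ j ∈ Finset.range k, g t (a' j) :=
          Finset.sum_congr rfl fun j hj ↦ by rw [h j (Finset.mem_range.1 hj)]
        funext x
        simp only [hf, h1, h2])
    (by
      rintro (i | t | t | t) k a x
      · exact (hind _ _).1
      · exact div_nonneg (le_min hB.le (Finset.sum_nonneg fun j _ ↦ (hind _ _).1)) hB.le
      · exact div_nonneg (hg0 t x) hb.le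
      · simp only [hf]
        split_ifs
        · exact (hind _ _).1
        · exact le_rfl)
    (by
      rintro (i | t | t | t) k a x
      · exact (hind _ _).2
      · exact (div_le_one hB).2 (min_le_left _ _)
      · exact (div_le_one hb).2 (hPb t x)
      · simp only [hf]
        split_ifs
        · exact (hind _ _).2
        · exact zero_le_one)
    (by
      rintro (i | t | t | t) k a
      · exact measurable_one.indicator (hQ i)
      · refine (measurable_const.min (Finset.measurable_sum _ fun j _ ↦ ?_)).div_const _
        exact (measurable_one.indicator (hP t)).comp measurable_prodMk_left
      · exact (hgm t).div_const _
      · simp only [hf]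
        split_ifs
        · exact measurable_one.indicator (hUm t k a)
        · exact measurable_const)
    (by
      rintro (i | t | t | t) k hk a
      · exact (hindint (hQ i)).le
      · simp only [hf, hq, integral_div]
        gcongr
        have hi (j) : Integrable (fun x ↦ (P t).indicator (1 : Ω × Ω → ℝ) (a j, x)) μ :=
          hindi (hm1 t (a j))
        calc ∫ x, min B (∑ j ∈ Finset.range k, (P t).indicator 1 (a j, x)) ∂μ
            ≤ ∫ x, ∑ j ∈ Finset.range k, (P t).indicator 1 (a j, x) ∂μ := by
              refine integral_mono ((integrable_const B).inf
                (integrable_finsetSum _ fun j _ ↦ hi j))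
                (integrable_finsetSum _ fun j _ ↦ hi j) fun x ↦ min_le_right _ _
          _ = ∑ j ∈ Finset.range k, μ.real {y | (a j, y) ∈ P t} := by
              rw [integral_finsetSum _ fun j _ ↦ hi j]
              exact Finset.sum_congr rfl fun j _ ↦ hindint (hm1 t (a j))
          _ ≤ ∑ j ∈ Finset.range k, p := Finset.sum_le_sum fun j _ ↦ hPp t (a j)
          _ = k * p := by simp
          _ ≤ M * p := by
              have := hpos t
              gcongr
      · simp only [hf, hq, integral_div]
        gcongr
        exact hgint t
      · simp only [hf, hq]
        split_ifs with h
        · rw [hindint (hUm t k a)]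
          exact (measureReal_biUnion_finset_le _ _).trans h
        · simpa using hs0 t)
  have hcard : (Fintype.card (ι ⊕ κ ⊕ κ ⊕ κ) : ℝ) = Fintype.card ι + 3 * Fintype.card κ := by
    simp only [Fintype.card_sum]
    push_cast
    ring
  rw [hcard, ← hL] at ha
  refine ⟨a, fun i ↦ ha (.inl i), fun t ↦ ?_, fun t ↦ ?_⟩
  · have h := ha (.inr (.inl t))
    simp only [hf, hq, ← Finset.sum_div] at h
    rw [div_le_iff₀ hB] at h
    refine h.trans_eq ?_
    field_simp
  · have h3 := ha (.inr (.inr (.inl t)))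
    simp only [hf, hq, ← Finset.sum_div] at h3
    rw [div_le_iff₀ hb] at h3
    have h3' : ∑ j ∈ Finset.range M, g t (a j) ≤ s := by
      refine h3.trans_eq ?_
      rw [hs]
      field_simp
    have h := ha (.inr (.inr (.inr t)))
    simp only [hf, hq] at h
    refine le_trans (Finset.sum_le_sum fun k hk ↦ ?_) h
    rw [if_pos]
    refine le_trans (Finset.sum_le_sum_of_subset_of_nonneg ?_ fun j _ _ ↦ hg0 t _) h3'
    exact Finset.range_subset_range.2 (Finset.mem_range.1 hk).le

lemma exists_finset_sphere_net (n : ℕ) {L : ℕ} (hL : 0 < L) :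
    ∃ s : Finset (EuclideanSpace ℝ (Fin n)), (∀ c ∈ s, ‖c‖ = 1) ∧
      (∀ c : EuclideanSpace ℝ (Fin n), ‖c‖ = 1 → ∃ c' ∈ s, ‖c - c'‖ ≤ 1 / L) ∧
      s.card ≤ (2 * (n * L) + 1) ^ n := by
  classical
  set N : ℕ := n * L with hN
  set T : Finset (Fin n → ℤ) := Fintype.piFinset fun _ ↦ Finset.Icc (-(N : ℤ)) N with hT
  set φ : EuclideanSpace ℝ (Fin n) → Fin n → ℤ := fun c i ↦ ⌊(N : ℝ) * c i⌋ with hφ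
  have hφT (c : EuclideanSpace ℝ (Fin n)) (hc : ‖c‖ = 1) : φ c ∈ T := by
    refine Fintype.mem_piFinset.2 fun i ↦ Finset.mem_Icc.2 ?_
    have h1 : |c i| ≤ 1 := by
      have := PiLp.norm_apply_le c i
      rwa [hc, Real.norm_eq_abs] at this
    obtain ⟨h2, h3⟩ := abs_le.1 h1
    have hN0 : (0 : ℝ) ≤ N := by positivity
    constructor
    · refine Int.le_floor.2 ?_
      push_cast
      nlinarith
    · refine Int.floor_le_iff.2 ?_
      push_cast
      nlinarith
  set ψ : (Fin n → ℤ) → EuclideanSpace ℝ (Fin n) := fun v ↦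
    if h : ∃ c : EuclideanSpace ℝ (Fin n), ‖c‖ = 1 ∧ φ c = v then h.choose else 0 with hψ
  refine ⟨(T.image ψ).filter fun c ↦ ‖c‖ = 1, fun c hc ↦ (Finset.mem_filter.1 hc).2,
    fun c hc ↦ ?_, ?_⟩
  · have hex : ∃ c' : EuclideanSpace ℝ (Fin n), ‖c'‖ = 1 ∧ φ c' = φ c := ⟨c, hc, rfl⟩
    have h1 : ψ (φ c) = hex.choose := dif_pos hex
    obtain ⟨h2, h3⟩ := hex.choose_spec
    rw [← h1] at h2 h3
    refine ⟨ψ (φ c), Finset.mem_filter.2 ⟨Finset.mem_image_of_mem _ (hφT c hc), h2⟩, ?_⟩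
    have hn : n ≠ 0 := by
      rintro rfl
      rw [Subsingleton.elim c 0, norm_zero] at hc
      exact zero_ne_one hc
    have hNpos : (0 : ℝ) < N := by
      have : 0 < N := Nat.mul_pos (Nat.pos_of_ne_zero hn) hL
      exact_mod_cast this
    have hcoord (i : Fin n) : |(c - ψ (φ c)) i| ≤ 1 / N := by
      have h4 : ⌊(N : ℝ) * ψ (φ c) i⌋ = ⌊(N : ℝ) * c i⌋ := congrFun h3 i
      have h5 := Int.abs_sub_lt_one_of_floor_eq_floor h4.symm
      rw [← mul_sub, abs_mul, abs_of_pos hNpos] at h5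
      rw [le_div_iff₀ hNpos, mul_comm]
      exact h5.le
    calc ‖c - ψ (φ c)‖ = ‖∑ i, EuclideanSpace.single i ((c - ψ (φ c)) i)‖ := by
          congr 1
          ext j
          simp
      _ ≤ ∑ i : Fin n, ‖EuclideanSpace.single i ((c - ψ (φ c)) i)‖ := norm_sum_le _ _
      _ ≤ ∑ i : Fin n, 1 / (N : ℝ) := Finset.sum_le_sum fun i _ ↦ by
          rw [PiLp.norm_single, Real.norm_eq_abs]
          exact hcoord i
      _ = 1 / L := by
          have : (L : ℝ) ≠ 0 := by exact_mod_cast hL.ne'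
          have : (n : ℝ) ≠ 0 := by exact_mod_cast hn
          simp only [Finset.sum_const, Finset.card_univ, Fintype.card_fin, nsmul_eq_mul, hN]
          push_cast
          field_simp
  · refine (Finset.card_filter_le _ _).trans (Finset.card_image_le.trans ?_)
    simp only [hT, Fintype.card_piFinset, Int.card_Icc, Finset.prod_const, Finset.card_univ,
      Fintype.card_fin]
    refine Nat.pow_le_pow_left ?_ n
    omega

lemma exists_grid_point {L : ℕ} (hL : 0 < L) {θ : ℝ} (h1 : θ ≤ 1) :
    ∃ l : Fin (L + 1), θ - 2 / L ≤ (l : ℝ) / L ∧ (l : ℝ) / L ≤ max 0 (θ - 1 / L) := by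
  have hL0 : (0 : ℝ) < L := by exact_mod_cast hL
  have hle : ⌊θ * L - 1⌋₊ ≤ L := by
    refine Nat.floor_le_of_le ?_
    nlinarith
  refine ⟨⟨⌊θ * L - 1⌋₊, by omega⟩, ?_, ?_⟩
  · have := Nat.lt_floor_add_one (θ * L - 1)
    rw [le_div_iff₀ hL0, sub_mul, div_mul_cancel₀ _ hL0.ne']
    simp only
    linarith
  · simp only
    rcases le_total (θ * L - 1) 0 with h | h
    · rw [Nat.floor_of_nonpos h]
      simp
    · refine le_max_of_le_right ?_
      have := Nat.floor_le h
      rw [div_le_iff₀ hL0, sub_mul, div_mul_cancel₀ _ hL0.ne']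
      linarith

/-- A vector correlated with two nearly orthogonal unit vectors is strongly correlated with one of
two fixed unit vectors of the plane they span. -/
lemma exists_unit_pair_abs_inner_ge {E : Type*} [NormedAddCommGroup E] [InnerProductSpace ℝ E]
    {u c : E} (hu : ‖u‖ = 1) (hc : ‖c‖ = 1) {α β γ : ℝ} (hα : 0 < α) (hβ : 0 ≤ β) (hγ : γ < 1)
    (huc : |⟪u, c⟫| ≤ γ) :
    ∃ v w : E, ‖v‖ = 1 ∧ ‖w‖ = 1 ∧ ∀ x : E, α ≤ |⟪x, u⟫| → β ≤ |⟪x, c⟫| →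
      √((α ^ 2 + β ^ 2) / (1 + γ)) ≤ |⟪x, v⟫| ∨ √((α ^ 2 + β ^ 2) / (1 + γ)) ≤ |⟪x, w⟫| := by
  have hγ0 : 0 ≤ γ := (abs_nonneg _).trans huc
  obtain ⟨hl, hr⟩ := abs_le.1 huc
  have hS : 0 < α ^ 2 + β ^ 2 := by positivity
  have key (σ : ℝ) (hσ : |σ| = 1) : 0 < ‖α • u + (σ * β) • c‖ ∧
      ‖α • u + (σ * β) • c‖ ^ 2 ≤ (α ^ 2 + β ^ 2) * (1 + γ) := by
    have hσ2 : σ ^ 2 = 1 := by rw [← sq_abs, hσ, one_pow]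
    have h1 : ‖α • u + (σ * β) • c‖ ^ 2 = α ^ 2 + β ^ 2 + 2 * (α * β) * (σ * ⟪u, c⟫) := by
      rw [norm_add_sq_real, norm_smul, norm_smul, hu, hc, real_inner_smul_left,
        real_inner_smul_right, mul_one, mul_one, Real.norm_eq_abs, Real.norm_eq_abs, sq_abs,
        sq_abs, mul_pow, hσ2]
      ring
    have h2 : |σ * ⟪u, c⟫| ≤ γ := by rwa [abs_mul, hσ, one_mul]
    obtain ⟨h3, h4⟩ := abs_le.1 h2
    have h5 : 0 ≤ α * β := by positivity
    have h6 : 2 * (α * β) ≤ α ^ 2 + β ^ 2 := by nlinarith [sq_nonneg (α - β)]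
    refine ⟨?_, ?_⟩
    · refine (norm_nonneg _).lt_of_ne fun h0 ↦ ?_
      rw [← h0] at h1
      nlinarith
    · rw [h1]
      nlinarith
  have fin (σ : ℝ) (hσ : |σ| = 1) (x : E) (hx : α ^ 2 + β ^ 2 ≤ |⟪x, α • u + (σ * β) • c⟫|) :
      √((α ^ 2 + β ^ 2) / (1 + γ)) ≤
        |⟪x, ‖α • u + (σ * β) • c‖⁻¹ • (α • u + (σ * β) • c)⟫| := by
    obtain ⟨h1, h2⟩ := key σ hσ
    rw [real_inner_smul_right, abs_mul, abs_of_pos (inv_pos.2 h1), ← div_eq_inv_mul,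
      le_div_iff₀ h1]
    refine le_trans ?_ hx
    refine (mul_le_mul_of_nonneg_left (Real.le_sqrt_of_sq_le h2) (Real.sqrt_nonneg _)).trans ?_
    rw [← Real.sqrt_mul (by positivity)]
    refine Real.sqrt_le_iff.2 ⟨hS.le, le_of_eq ?_⟩
    field_simp
  have hunit (σ : ℝ) (hσ : |σ| = 1) :
      ‖‖α • u + (σ * β) • c‖⁻¹ • (α • u + (σ * β) • c)‖ = 1 := by
    rw [norm_smul, norm_inv, norm_norm, inv_mul_cancel₀ (key σ hσ).1.ne']
  refine ⟨_, _, hunit 1 (by simp), hunit (-1) (by simp), fun x hxu hxc ↦ ?_⟩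
  have hin (σ : ℝ) : ⟪x, α • u + (σ * β) • c⟫ = α * ⟪x, u⟫ + σ * (β * ⟪x, c⟫) := by
    rw [inner_add_right, real_inner_smul_right, real_inner_smul_right]
    ring
  have habs : |α * ⟪x, u⟫| + |β * ⟪x, c⟫| ≥ α ^ 2 + β ^ 2 := by
    rw [abs_mul, abs_mul, abs_of_pos hα, abs_of_nonneg hβ]
    nlinarith
  rcases le_total 0 (α * ⟪x, u⟫ * (β * ⟪x, c⟫)) with h | h
  · left
    refine fin 1 (by simp) x ?_
    rw [hin, one_mul, abs_add_eq_add_abs_iff _ _ |>.2]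
    · exact habs
    · rcases mul_nonneg_iff.1 h with h | h <;> tauto
  · right
    refine fin (-1) (by simp) x ?_
    rw [hin, neg_one_mul, abs_add_eq_add_abs_iff _ _ |>.2, abs_neg]
    · exact habs
    · rcases mul_nonpos_iff.1 h with h | h
      · exact Or.inl ⟨h.1, by linarith⟩
      · exact Or.inr ⟨h.1, by linarith⟩

lemma measureReal_two_caps_le {E : Type*} [NormedAddCommGroup E] [InnerProductSpace ℝ E]
    {Ω : Type*} [MeasurableSpace Ω] {μ : Measure Ω} [IsFiniteMeasure μ] {f : Ω → E} {r D : ℝ}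
    (hμ : ∀ c : E, ‖c‖ = 1 → ∀ t, 0 ≤ t → 1 - t ^ 2 ≤ r ^ 2 → μ.real {x | t ≤ |⟪f x, c⟫|} ≤ D)
    {u c : E} (hu : ‖u‖ = 1) (hc : ‖c‖ = 1) {α β γ : ℝ} (hα : 0 < α) (hβ : 0 ≤ β) (hγ : γ < 1)
    (huc : |⟪u, c⟫| ≤ γ) (hr : 1 - (α ^ 2 + β ^ 2) / (1 + γ) ≤ r ^ 2) :
    μ.real {x | α ≤ |⟪f x, u⟫| ∧ β ≤ |⟪f x, c⟫|} ≤ 2 * D := by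
  have hγ0 : 0 ≤ γ := (abs_nonneg _).trans huc
  obtain ⟨v, w, hv, hw, h⟩ := exists_unit_pair_abs_inner_ge hu hc hα hβ hγ huc
  have ht : 1 - √((α ^ 2 + β ^ 2) / (1 + γ)) ^ 2 ≤ r ^ 2 := by
    rwa [Real.sq_sqrt (by positivity)]
  calc _ ≤ μ.real ({x | √((α ^ 2 + β ^ 2) / (1 + γ)) ≤ |⟪f x, v⟫|} ∪
        {x | √((α ^ 2 + β ^ 2) / (1 + γ)) ≤ |⟪f x, w⟫|}) :=
        measureReal_mono fun x hx ↦ h (f x) hx.1 hx.2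
    _ ≤ _ := measureReal_union_le _ _
    _ ≤ 2 * D := by
        linarith [hμ v hv _ (Real.sqrt_nonneg _) ht, hμ w hw _ (Real.sqrt_nonneg _) ht]

lemma sum_indicator_one_eq_card_filter {Ω : Type*} (s : Finset ℕ) (A : ℕ → Set Ω) (x : ℕ → Ω)
    [DecidablePred fun k ↦ x k ∈ A k] :
    ∑ k ∈ s, (A k).indicator (1 : Ω → ℝ) (x k) = (s.filter fun k ↦ x k ∈ A k).card := by
  classical
  simp [Set.indicator_apply]

lemma abs_inner_sub_abs_inner_le {E : Type*} [NormedAddCommGroup E] [InnerProductSpace ℝ E]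
    {x : E} (hx : ‖x‖ = 1) (c c' : E) : |⟪x, c⟫| - |⟪x, c'⟫| ≤ ‖c - c'‖ := by
  refine (abs_sub_abs_le_abs_sub _ _).trans ?_
  rw [← inner_sub_right]
  simpa [hx] using abs_real_inner_le_norm x (c - c')

lemma sq_sub_sq_le_of_sub_le {x y h : ℝ} (hyx : y ≤ x) (hx : x ≤ 1)
    (h2 : x - 2 * h ≤ y) : x ^ 2 - y ^ 2 ≤ 4 * h := by
  nlinarith

lemma one_sub_sq_le_of_grid {x y h z ρ σ : ℝ} (hz : 0 < z) (hzρ : z ≤ ρ) (hh : 0 ≤ h)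
    (hσ : 1 + 4 * h / z ^ 2 ≤ σ ^ 2) (hxy : x ^ 2 - y ^ 2 ≤ 4 * h) (hx : 1 - x ^ 2 ≤ ρ ^ 2) :
    1 - y ^ 2 ≤ (σ * ρ) ^ 2 := by
  have h1 : 4 * h ≤ 4 * h / z ^ 2 * ρ ^ 2 := by
    rw [div_mul_eq_mul_div, le_div_iff₀ (by positivity)]
    gcongr
  have h2 : (1 + 4 * h / z ^ 2) * ρ ^ 2 ≤ σ ^ 2 * ρ ^ 2 := by gcongr
  rw [mul_pow]
  linarith

lemma one_sub_sum_sq_div_le {w h η z e S : ℝ} (hw : 0 < w) (hw8 : w < 1 / 8) (hh : 0 < h)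
    (hhw : h ≤ w / 16) (hη : 8 * w < η) (hz : 0 < z) (hz1 : z ≤ 1) (he : 1 - 4 * w ^ 2 ≤ e ^ 2)
    (hS : 1 + η - z ^ 2 - 8 * h ≤ S) : 1 - S / (1 + (2 * w + h)) ≤ (z * e) ^ 2 := by
  have h1 : z ^ 2 ≤ 1 := by nlinarith
  have h2 : z ^ 2 - 4 * w ^ 2 ≤ (z * e) ^ 2 := by
    rw [mul_pow]
    nlinarith [sq_nonneg z, sq_nonneg w]
  have h3 : 0 ≤ (z * e) ^ 2 * (2 * w + h) := by positivity
  have h4 : 4 * w ^ 2 ≤ w / 2 := by nlinarith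
  have h5 : (1 - (z * e) ^ 2) * (1 + (2 * w + h)) ≤ S := by linarith
  rw [← le_div_iff₀ (by positivity)] at h5
  linarith

open Classical in
lemma card_filter_le_of_grid {Ω E : Type*} [MeasurableSpace Ω] [NormedAddCommGroup E]
    [InnerProductSpace ℝ E] {n M L : ℕ} (hL : 0 < L) {z e σ D Λ : ℝ} (hz : 0 < z) (hz1 : z ≤ 1)
    (he1 : e ≤ 1) (hMz : M * z ^ n = 1) (hσ1 : 1 ≤ σ)
    (hσ : 1 + 4 / (L * z ^ 2) ≤ σ ^ 2) (hD : 0 ≤ D) (hΛ0 : 0 ≤ Λ) {μ : Measure Ω}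
    {f : Ω → E} (hnorm : ∀ x, ‖f x‖ = 1)
    (hμ : ∀ c : E, ‖c‖ = 1 → ∀ t r, 0 ≤ t → z * e ≤ r → r ≤ 1 →
      1 - t ^ 2 ≤ r ^ 2 → μ.real {x | t ≤ |⟪f x, c⟫|} ≤ D * r ^ n)
    {s : Finset E} (hs1 : ∀ c ∈ s, ‖c‖ = 1)
    (hs : ∀ c : E, ‖c‖ = 1 → ∃ c' ∈ s, ‖c - c'‖ ≤ 1 / L) {a : ℕ → Ω}
    (ha : ∀ c ∈ s, ∀ l : Fin (L + 1),
      (((Finset.range M).filter fun k ↦ (l : ℝ) / L ≤ |⟪f (a k), c⟫|).card : ℝ) ≤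
        2 * M * μ.real {x | (l : ℝ) / L ≤ |⟪f x, c⟫|} + Λ)
    {c : E} (hc : ‖c‖ = 1) {θ ρ : ℝ} (hθ0 : 0 ≤ θ) (hθ1 : θ ≤ 1) (hρ : z ≤ ρ)
    (hθρ : 1 - θ ^ 2 ≤ ρ ^ 2) :
    (((Finset.range M).filter fun k ↦ θ ≤ |⟪f (a k), c⟫|).card : ℝ) ≤
      (2 * D + Λ) * σ ^ n * (M * ρ ^ n) := by
  have hL0 : (0 : ℝ) < L := by exact_mod_cast hL
  have hh0 : 0 < 1 / (L : ℝ) := by positivity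
  have hh2 : 2 / (L : ℝ) = 2 * (1 / L) := by ring
  obtain ⟨c', hc', hcc'⟩ := hs c hc
  obtain ⟨l, hl1, hl2⟩ := exists_grid_point hL hθ1
  have hl0 : 0 ≤ (l : ℝ) / L := by positivity
  have hlθ : (l : ℝ) / L ≤ θ := hl2.trans (max_le hθ0 (by linarith))
  set r : ℝ := min 1 (σ * ρ) with hr
  have hρ0 : 0 < ρ := hz.trans_le hρ
  have hzr : z ≤ r := le_min hz1 (by nlinarith)
  have hr0 : 0 < r := hz.trans_le hzr
  have hlr : 1 - ((l : ℝ) / L) ^ 2 ≤ r ^ 2 := by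
    rcases min_choice 1 (σ * ρ) with h | h <;> rw [hr, h]
    · nlinarith
    · exact one_sub_sq_le_of_grid hz hρ hh0.le (by rwa [mul_one_div, div_div])
        (sq_sub_sq_le_of_sub_le hlθ hθ1 (by rwa [← hh2])) hθρ
  have h2 : μ.real {x | (l : ℝ) / L ≤ |⟪f x, c'⟫|} ≤ D * r ^ n :=
    hμ c' (hs1 c' hc') _ r hl0 ((mul_le_of_le_one_right hz.le he1).trans hzr) (min_le_left _ _) hlr
  have h3 : (((Finset.range M).filter fun k ↦ θ ≤ |⟪f (a k), c⟫|).card : ℝ) ≤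
      ((Finset.range M).filter fun k ↦ (l : ℝ) / L ≤ |⟪f (a k), c'⟫|).card := by
    refine Nat.cast_le.2 (Finset.card_le_card fun k hk ↦ ?_)
    rw [Finset.mem_filter] at hk ⊢
    refine ⟨hk.1, hl2.trans (max_le (abs_nonneg _) ?_)⟩
    have := abs_inner_sub_abs_inner_le (hnorm (a k)) c c'
    linarith [hk.2]
  have h4 : r ^ n ≤ σ ^ n * ρ ^ n := by
    rw [← mul_pow]
    exact pow_le_pow_left₀ hr0.le (min_le_right _ _) n
  have h5 : 1 ≤ M * r ^ n := by
    rw [← hMz]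
    gcongr
  calc _ ≤ _ := h3
    _ ≤ _ := ha c' hc' l
    _ ≤ 2 * M * (D * r ^ n) + Λ * (M * r ^ n) := by
      gcongr
      exact le_mul_of_one_le_right hΛ0 h5
    _ = (2 * D + Λ) * M * r ^ n := by ring
    _ ≤ (2 * D + Λ) * M * (σ ^ n * ρ ^ n) := by gcongr
    _ = _ := by ring

open Classical in
lemma card_filter_exists_ne_le (M : ℕ) {T P : ℕ → ℕ → Prop} {U : ℕ → Prop}
    [DecidablePred fun i ↦ ∃ j ∈ Finset.range M, j ≠ i ∧ T i j] (h : ∀ i j, ¬ U i → T i j → P i j) :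
    ((Finset.range M).filter fun i ↦ ∃ j ∈ Finset.range M, j ≠ i ∧ T i j).card ≤
      ((Finset.range M).filter U).card +
        (((Finset.range M).filter fun i ↦ ∃ j < i, P i j).card +
          ∑ k ∈ Finset.range M, ((Finset.range k).filter fun i ↦ P i k).card) := by
  have hsum : ((Finset.range M).filter fun i ↦ ∃ j ∈ Finset.range M, i < j ∧ P i j).card ≤
      ∑ k ∈ Finset.range M, ((Finset.range k).filter fun i ↦ P i k).card := by
    refine le_trans (Finset.card_le_card fun i hi ↦ ?_) Finset.card_biUnion_le
    obtain ⟨-, j, hj, hij, hP⟩ := Finset.mem_filter.1 hi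
    exact Finset.mem_biUnion.2 ⟨j, hj, Finset.mem_filter.2 ⟨Finset.mem_range.2 hij, hP⟩⟩
  refine le_trans (Finset.card_le_card fun i hi ↦ ?_) ((Finset.card_union_le _ _).trans
    (Nat.add_le_add_left ((Finset.card_union_le _ _).trans (Nat.add_le_add_left hsum _)) _))
  obtain ⟨hi, j, hj, hji, hT⟩ := Finset.mem_filter.1 hi
  simp only [Finset.mem_union, Finset.mem_filter, hi, true_and]
  by_cases hU : U i
  · exact Or.inl hU
  · rcases lt_or_gt_of_ne hji with hlt | hlt
    · exact Or.inr (Or.inl ⟨j, hlt, h i j hU hT⟩)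
    · exact Or.inr (Or.inr ⟨j, hj, hlt, h i j hU hT⟩)

/-- `y` is correlated both with `x` and with a direction `c` nearly orthogonal to `x`. -/
def CapRel {Ω E : Type*} [NormedAddCommGroup E] [InnerProductSpace ℝ E] (f : Ω → E) (c : E)
    (γ α β : ℝ) (x y : Ω) : Prop :=
  |⟪f x, c⟫| ≤ γ ∧ α ≤ |⟪f y, f x⟫| ∧ β ≤ |⟪f y, c⟫|

open Classical in
lemma exists_seq_grid_counts_le {Ω E : Type*} [MeasurableSpace Ω] [NormedAddCommGroup E]
    [InnerProductSpace ℝ E] [MeasurableSpace E] [BorelSpace E] [SecondCountableTopology E]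
    {n L : ℕ} (M : ℕ) {z e D Λ γ B : ℝ} (hz : 0 < z) (he0 : 0 < e) (hz1 : z ≤ 1) (he1 : e ≤ 1)
    (hγ1 : γ < 1) (hD : 0 < D) (hB : 0 < B) (μ : Measure Ω) [IsProbabilityMeasure μ]
    {f : Ω → E} (hf : Measurable f) (hnorm : ∀ x, ‖f x‖ = 1)
    (hμ : ∀ c : E, ‖c‖ = 1 → ∀ t r, 0 ≤ t → z * e ≤ r → r ≤ 1 →
      1 - t ^ 2 ≤ r ^ 2 → μ.real {x | t ≤ |⟪f x, c⟫|} ≤ D * r ^ n)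
    {s : Finset E} (hsne : s.Nonempty) (hs1 : ∀ c ∈ s, ‖c‖ = 1)
    (hΛ : Real.log (4 * (s.card * (L + 1) ^ 2)) ≤ Λ) :
    ∃ a : ℕ → Ω, (∀ c ∈ s, ∀ l : Fin (L + 1),
        (((Finset.range M).filter fun k ↦ (l : ℝ) / L ≤ |⟪f (a k), c⟫|).card : ℝ) ≤
          2 * M * μ.real {x | (l : ℝ) / L ≤ |⟪f x, c⟫|} + Λ) ∧
      ∀ c ∈ s, ∀ l l' : Fin (L + 1), 0 < (l : ℝ) / L → 1 - ((l : ℝ) / L) ^ 2 ≤ e ^ 2 →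
        1 - (((l : ℝ) / L) ^ 2 + ((l' : ℝ) / L) ^ 2) / (1 + γ) ≤ (z * e) ^ 2 →
        ∑ k ∈ Finset.range M, min B ((Finset.range k).filter fun j ↦
          CapRel f c γ (l / L) (l' / L) (a j) (a k)).card ≤
            2 * M * (M * (2 * (D * (z * e) ^ n))) + B * Λ ∧
        (((Finset.range M).filter fun k ↦ ∃ j < k,
          CapRel f c γ (l / L) (l' / L) (a k) (a j)).card : ℝ) ≤
            2 * M * (2 * M * (2 * (D * (z * e) ^ n)) + D * e ^ n * Λ) + Λ := by
  let κ := {t : s × Fin (L + 1) × Fin (L + 1) // 0 < ((t.2.1 : ℝ) / L) ∧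
    1 - ((t.2.1 : ℝ) / L) ^ 2 ≤ e ^ 2 ∧
    1 - (((t.2.1 : ℝ) / L) ^ 2 + ((t.2.2 : ℝ) / L) ^ 2) / (1 + γ) ≤ (z * e) ^ 2}
  let Q : s × Fin (L + 1) → Set Ω := fun t ↦ {x | (t.2 : ℝ) / L ≤ |⟪f x, (t.1 : E)⟫|}
  let P : κ → Set (Ω × Ω) := fun t ↦
    {x | CapRel f (t.1.1 : E) γ (t.1.2.1 / L) (t.1.2.2 / L) x.1 x.2}
  have hQm (t) : MeasurableSet (Q t) := measurableSet_le (by fun_prop) (by fun_prop)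
  have hPm (t) : MeasurableSet (P t) :=
    (measurableSet_le (f := fun x : Ω × Ω ↦ |⟪f x.1, (t.1.1 : E)⟫|) (by fun_prop)
      (by fun_prop)).inter
      ((measurableSet_le (g := fun x : Ω × Ω ↦ |⟪f x.2, f x.1⟫|) (by fun_prop)
        (by fun_prop)).inter
        (measurableSet_le (g := fun x : Ω × Ω ↦ |⟪f x.2, (t.1.1 : E)⟫|) (by fun_prop)
          (by fun_prop)))
  have : Nonempty s := hsne.to_subtype
  have hze1 : z * e ≤ 1 := mul_le_one₀ hz1 he0.le he1
  have hzee : z * e ≤ e := mul_le_of_le_one_left he0.le hz1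
  have hΛ' : Real.log (Fintype.card (s × Fin (L + 1)) + 3 * Fintype.card κ) ≤ Λ := by
    refine le_trans (Real.log_le_log ?_ ?_) hΛ
    · have : (0 : ℝ) < Fintype.card (s × Fin (L + 1)) := by exact_mod_cast Fintype.card_pos
      positivity
    · have h1 : Fintype.card κ ≤ s.card * (L + 1) ^ 2 := by
        refine (Fintype.card_subtype_le _).trans (le_of_eq ?_)
        simp only [Fintype.card_prod, Fintype.card_coe, Fintype.card_fin]
        ring
      have h2 : Fintype.card (s × Fin (L + 1)) ≤ s.card * (L + 1) ^ 2 := by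
        simp only [Fintype.card_prod, Fintype.card_coe, Fintype.card_fin]
        gcongr
        nlinarith
      have h1' : (Fintype.card κ : ℝ) ≤ s.card * (L + 1) ^ 2 := by exact_mod_cast h1
      have h2' : (Fintype.card (s × Fin (L + 1)) : ℝ) ≤ s.card * (L + 1) ^ 2 := by
        exact_mod_cast h2
      linarith
  obtain ⟨a, ha1, ha2, ha3⟩ := exists_seq_counts_le μ M Q hQm P hPm
    (p := 2 * (D * (z * e) ^ n)) (b := D * e ^ n) (B := B) (by positivity) hB
    (by
      rintro ⟨⟨c, l, l'⟩, h1, h2, h3⟩ x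
      by_cases hx : |⟪f x, (c : E)⟫| ≤ γ
      · refine le_trans (measureReal_mono fun y hy ↦ ?_) (measureReal_two_caps_le (f := f)
          (fun v hv t ht htr ↦ hμ v hv t (z * e) ht le_rfl hze1 htr) (hnorm x)
          (hs1 c c.2) h1 (β := (l' : ℝ) / L) (by positivity) hγ1 hx h3)
        exact hy.2
      · have : {y | (x, y) ∈ P ⟨⟨c, l, l'⟩, h1, h2, h3⟩} = ∅ :=
          Set.eq_empty_of_forall_notMem fun y hy ↦ hx hy.1
        rw [this, measureReal_empty]
        positivity)
    (by
      rintro ⟨⟨c, l, l'⟩, h1, h2, h3⟩ y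
      refine le_trans (measureReal_mono fun x hx ↦ ?_)
        (hμ (f y) (hnorm y) ((l : ℝ) / L) e h1.le hzee he1 h2)
      have : (l : ℝ) / L ≤ |⟪f y, f x⟫| := hx.2.1
      rwa [real_inner_comm] at this)
  refine ⟨a, fun c hc l ↦ ?_, fun c hc l l' h1 h2 h3 ↦ ?_⟩
  · have h1 := ha1 (⟨c, hc⟩, l)
    rw [sum_indicator_one_eq_card_filter] at h1
    exact h1.trans (add_le_add_right hΛ' _)
  · let t : κ := ⟨(⟨c, hc⟩, l, l'), h1, h2, h3⟩
    have hbwd := ha2 t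
    have hfwd := ha3 t
    rw [sum_indicator_one_eq_card_filter (Finset.range M)
      (fun k ↦ ⋃ j ∈ Finset.range k, {x | (x, a j) ∈ P t}) a] at hfwd
    have hcard (k : ℕ) : ∑ j ∈ Finset.range k, (P t).indicator (1 : Ω × Ω → ℝ) (a j, a k) =
        ((Finset.range k).filter fun j ↦ (a j, a k) ∈ P t).card :=
      sum_indicator_one_eq_card_filter (Finset.range k) (fun _ ↦ P t) fun j ↦ (a j, a k)
    simp only [hcard] at hbwd
    simp only [Set.mem_iUnion, Finset.mem_range, exists_prop] at hfwd
    refine ⟨hbwd.trans ?_, hfwd.trans ?_⟩ <;> gcongr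

set_option maxHeartbeats 400000 in
open Classical in
lemma exists_code_of_bounds {Ω E : Type*} [MeasurableSpace Ω] [NormedAddCommGroup E]
    [InnerProductSpace ℝ E] [MeasurableSpace E] [BorelSpace E] [SecondCountableTopology E]
    {n M L : ℕ} (hL : 0 < L) {ε η z e σ D Λ : ℝ} (hz : 0 < z)
    (hze : z ≤ e) (he1 : e ≤ 1) (he : 1 - 4 * ε ≤ e ^ 2) (hε : 0 < ε) (hη : 8 * √ε < η)
    (hη1 : η < 1) (hLε : 1 / (L : ℝ) ≤ √ε / 16) (hMz : M * z ^ n = 1) (hσ0 : 0 ≤ σ)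
    (hσ : 1 + 4 / (L * z ^ 2) ≤ σ ^ 2) (hD : 0 < D) (hΛ0 : 0 ≤ Λ)
    (μ : Measure Ω) [IsProbabilityMeasure μ] {f : Ω → E} (hf : Measurable f)
    (hnorm : ∀ x, ‖f x‖ = 1)
    (hμ : ∀ c : E, ‖c‖ = 1 → ∀ t r, 0 ≤ t → z * e ≤ r → r ≤ 1 →
      1 - t ^ 2 ≤ r ^ 2 → μ.real {x | t ≤ |⟪f x, c⟫|} ≤ D * r ^ n)
    (s : Finset E) (hs1 : ∀ c ∈ s, ‖c‖ = 1)
    (hs : ∀ c : E, ‖c‖ = 1 → ∃ c' ∈ s, ‖c - c'‖ ≤ 1 / L)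
    (hΛ : Real.log (4 * (s.card * (L + 1) ^ 2)) ≤ Λ) :
    ∃ a : ℕ → Ω,
      (∀ c : E, ‖c‖ = 1 → ∀ θ, 0 ≤ θ → θ ≤ 1 → ∀ ρ, z ≤ ρ →
        1 - θ ^ 2 ≤ ρ ^ 2 →
        (((Finset.range M).filter fun k ↦
          θ ≤ |⟪f (a k), c⟫|).card : ℝ) ≤
            (2 * D + Λ) * σ ^ n * (M * ρ ^ n)) ∧
      (∀ c : E, ‖c‖ = 1 → ∀ θ ζ, η ≤ θ → θ ≤ 1 → 0 ≤ ζ → ζ ≤ 1 →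
        1 + η - z ^ 2 < θ ^ 2 + ζ ^ 2 →
        (((Finset.range M).filter fun i ↦ ∃ j ∈ Finset.range M, j ≠ i ∧
          θ ≤ |⟪f (a j), f (a i)⟫| ∧
          ζ ≤ |⟪f (a j), c⟫|).card : ℝ) ≤
            M * e ^ n * (12 * D + 2 * D * Λ + Λ + (2 * D + Λ) * σ ^ n * (Λ + 1))) := by
  have hL0 : (0 : ℝ) < L := by exact_mod_cast hL
  have hw0 : 0 < √ε := Real.sqrt_pos.2 hε
  have hw2 : √ε ^ 2 = ε := Real.sq_sqrt hε.le
  have hw8 : √ε < 1 / 8 := by linarith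
  have hh0 : 0 < 1 / (L : ℝ) := by positivity
  have hh2 : 2 / (L : ℝ) = 2 * (1 / L) := by ring
  have he0 : 0 < e := hz.trans_le hze
  have hz1 : z ≤ 1 := hze.trans he1
  have hMn : (0 : ℝ) < M := by
    rcases Nat.eq_zero_or_pos M with h | h
    · simp [h] at hMz
    · exact_mod_cast h
  have hσ1 : 1 ≤ σ := by
    have : 0 ≤ 4 / (L * z ^ 2) := by positivity
    nlinarith
  set γ : ℝ := 2 * √ε + 1 / L with hγ
  have hγ1 : γ < 1 := by linarith
  have hsne : s.Nonempty := by
    obtain ⟨x⟩ := nonempty_of_isProbabilityMeasure μ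
    obtain ⟨c, hc, -⟩ := hs (f x) (hnorm x)
    exact ⟨c, hc⟩
  set C : ℝ := (2 * D + Λ) * σ ^ n with hC
  have hC0 : 0 < C := by positivity
  obtain ⟨a, ha1, ha2⟩ := exists_seq_grid_counts_le M (B := C * (M * e ^ n)) hz he0 hz1 he1 hγ1
    hD (by positivity) μ hf hnorm hμ hsne hs1 hΛ
  have hMρ {ρ : ℝ} (hρ : z ≤ ρ) : 1 ≤ M * ρ ^ n := by
    rw [← hMz]
    gcongr
  have cap : ∀ c : E, ‖c‖ = 1 → ∀ θ, 0 ≤ θ → θ ≤ 1 → ∀ ρ, z ≤ ρ → 1 - θ ^ 2 ≤ ρ ^ 2 →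
      (((Finset.range M).filter fun k ↦ θ ≤ |⟪f (a k), c⟫|).card : ℝ) ≤ C * (M * ρ ^ n) := by
    intro c hc θ hθ0 hθ1 ρ hρ hθρ
    exact card_filter_le_of_grid hL hz hz1 he1 hMz hσ1 hσ hD.le hΛ0 hnorm hμ hs1 hs ha1
      hc hθ0 hθ1 hρ hθρ
  refine ⟨a, cap, ?_⟩
  intro c hc θ ζ hθη hθ1 hζ0 hζ1 hθζ
  have hθ0 : 0 ≤ θ := by linarith
  obtain ⟨c', hc', hcc'⟩ := hs c hc
  obtain ⟨l, hl1, hl2⟩ := exists_grid_point hL hθ1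
  obtain ⟨l', hl1', hl2'⟩ := exists_grid_point hL hζ1
  have hα7 : 7 * √ε ≤ (l : ℝ) / L := by linarith
  have hβ0 : 0 ≤ (l' : ℝ) / L := by positivity
  have hlθ : (l : ℝ) / L ≤ θ := hl2.trans (max_le hθ0 (by linarith))
  have hlζ : (l' : ℝ) / L ≤ ζ := hl2'.trans (max_le hζ0 (by linarith))
  have hα1 : 1 - ((l : ℝ) / L) ^ 2 ≤ e ^ 2 := by
    have := pow_le_pow_left₀ (by positivity) hα7 2
    rw [mul_pow, hw2] at this
    linarith
  have hαβ : 1 - (((l : ℝ) / L) ^ 2 + ((l' : ℝ) / L) ^ 2) / (1 + γ) ≤ (z * e) ^ 2 := by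
    have h1 := sq_sub_sq_le_of_sub_le hlθ hθ1 (by rwa [← hh2])
    have h2 := sq_sub_sq_le_of_sub_le hlζ hζ1 (by rwa [← hh2])
    exact one_sub_sum_sq_div_le hw0 hw8 hh0 hLε hη hz hz1 (by rwa [hw2]) (by linarith)
  have hrel : ∀ i j, |⟪f (a i), c⟫| < 2 * √ε →
      θ ≤ |⟪f (a j), f (a i)⟫| →
      ζ ≤ |⟪f (a j), c⟫| → CapRel f c' γ (l / L) (l' / L) (a i) (a j) := by
    intro i j h1 h2 h3
    refine ⟨?_, hlθ.trans h2, hl2'.trans (max_le (abs_nonneg _) ?_)⟩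
    · have := abs_inner_sub_abs_inner_le (hnorm (a i)) c' c
      rw [norm_sub_rev] at this
      linarith
    · have := abs_inner_sub_abs_inner_le (hnorm (a j)) c c'
      linarith
  have hnear : (((Finset.range M).filter fun k ↦
      2 * √ε ≤ |⟪f (a k), c⟫|).card : ℝ) ≤ C * (M * e ^ n) :=
    cap c hc _ (by positivity) (by linarith) e hze
      (by rw [mul_pow, hw2]; linarith)
  have hMze : (M : ℝ) * (z * e) ^ n = e ^ n := by
    rw [mul_pow, ← mul_assoc, hMz, one_mul]
  obtain ⟨hbwd, hfwd⟩ := ha2 c' hc' l l' (by linarith) hα1 hαβ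
  have hmin (k : ℕ) (hk : k ∈ Finset.range M) :
      (((Finset.range k).filter fun j ↦ CapRel f c' γ (l / L) (l' / L) (a j) (a k)).card : ℝ) ≤
        C * (M * e ^ n) := by
    refine le_trans (Nat.cast_le.2 (Finset.card_le_card fun j hj ↦ ?_))
      (cap (f (a k)) (hnorm (a k)) ((l : ℝ) / L) (by positivity) (hlθ.trans hθ1) e hze hα1)
    rw [Finset.mem_filter, Finset.mem_range] at hj ⊢
    refine ⟨hj.1.trans (Finset.mem_range.1 hk), ?_⟩
    rw [real_inner_comm]
    exact hj.2.2.1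
  rw [Finset.sum_congr rfl fun k hk ↦ min_eq_right (hmin k hk), ← Nat.cast_sum] at hbwd
  have hcover := card_filter_exists_ne_le M
    (T := fun i j ↦ θ ≤ |⟪f (a j), f (a i)⟫| ∧ ζ ≤ |⟪f (a j), c⟫|)
    (U := fun i ↦ 2 * √ε ≤ |⟪f (a i), c⟫|)
    (P := fun i j ↦ CapRel f c' γ (l / L) (l' / L) (a i) (a j))
    (fun i j h1 h2 ↦ hrel i j (not_le.1 h1) h2.1 h2.2)
  refine ((Nat.cast_le (α := ℝ)).2 hcover).trans ?_
  push_cast at hbwd ⊢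
  refine (add_le_add hnear (add_le_add hfwd hbwd)).trans ?_
  have hΛM : Λ ≤ Λ * (M * e ^ n) := le_mul_of_one_le_right hΛ0 (hMρ hze)
  calc _ = C * (M * e ^ n) + 12 * M * D * (M * (z * e) ^ n) + 2 * M * D * e ^ n * Λ + Λ +
        C * (M * e ^ n) * Λ := by ring
    _ ≤ C * (M * e ^ n) + 12 * M * D * (M * (z * e) ^ n) + 2 * M * D * e ^ n * Λ +
        Λ * (M * e ^ n) + C * (M * e ^ n) * Λ := by gcongr
    _ = _ := by rw [hMze]; ring

lemma log_card_le {N L n : ℕ} (hN : N ≤ (2 * (n * L) + 1) ^ n) :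
    Real.log (4 * (N * (L + 1) ^ 2)) ≤ 4 * (L + 1) ^ 2 + 2 * L * n ^ 2 := by
  rcases Nat.eq_zero_or_pos N with rfl | hN0
  · simp only [Nat.cast_zero, zero_mul, mul_zero, Real.log_zero]
    positivity
  have hN0' : (0 : ℝ) < N := by exact_mod_cast hN0
  have h1 : Real.log (4 * (L + 1) ^ 2) ≤ 4 * (L + 1) ^ 2 := Real.log_le_self (by positivity)
  have h2 : Real.log N ≤ n * (2 * (n * L)) := by
    calc Real.log N ≤ Real.log ((2 * (n * L) + 1) ^ n) :=
          Real.log_le_log hN0' (by exact_mod_cast hN)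
      _ = n * Real.log (2 * (n * L) + 1) := Real.log_pow _ _
      _ ≤ n * (2 * (n * L)) := by
        gcongr
        have := Real.log_le_sub_one_of_pos (x := 2 * (n * L) + 1) (by positivity)
        linarith
  rw [show (4 * (N * (L + 1) ^ 2) : ℝ) = 4 * (L + 1) ^ 2 * N by ring,
    Real.log_mul (by positivity) hN0'.ne']
  linarith

lemma eventually_sq_quadratic_le_pow {A B w : ℝ} (hA : 0 < A) (hB : 0 ≤ B) (hw : 1 < w) :
    ∀ᶠ n : ℕ in Filter.atTop, 30 * (A + B * n ^ 2) ^ 2 ≤ w ^ n := by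
  have hc : 0 < 30 * (A + B) ^ 2 := by positivity
  filter_upwards [(isLittleO_pow_const_const_pow_of_one_lt (R := ℝ) 4 hw).bound (inv_pos.2 hc),
    Filter.eventually_ge_atTop 1] with n hn h1
  rw [Real.norm_of_nonneg (by positivity), Real.norm_of_nonneg (by positivity),
    inv_mul_eq_div, le_div_iff₀ hc] at hn
  have h1' : (1 : ℝ) ≤ n := by exact_mod_cast h1
  have h2 : A + B * n ^ 2 ≤ (A + B) * n ^ 2 := by
    have := le_mul_of_one_le_right hA.le (one_le_pow₀ h1' (n := 2))
    linarith
  calc 30 * (A + B * n ^ 2) ^ 2 ≤ 30 * ((A + B) * n ^ 2) ^ 2 := by gcongr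
    _ = n ^ 4 * (30 * (A + B) ^ 2) := by ring
    _ ≤ w ^ n := hn

lemma counting_constants_le {C W Λ : ℝ} (hC : 0 ≤ C) (hΛ : 0 ≤ Λ)
    (h : 30 * (C + Λ + 1) ^ 2 ≤ W) :
    (2 * (C * W) + Λ) * W ≤ W ^ 4 ∧
      12 * (C * W) + 2 * (C * W) * Λ + Λ + (2 * (C * W) + Λ) * W * (Λ + 1) ≤ W ^ 4 := by
  set T := C + Λ + 1 with hT
  have hT1 : 1 ≤ T := by linarith
  have hCT : C ≤ T := by linarith
  have hΛT : Λ + 1 ≤ T := by linarith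
  have hTT : T ≤ T ^ 2 := by nlinarith
  have hW : 1 ≤ W := by nlinarith
  have hWW : W ≤ W ^ 2 := by nlinarith
  have hW3 : W ^ 3 ≤ W ^ 4 := pow_le_pow_right₀ hW (by norm_num)
  have h1 : 2 * (C * W) + Λ ≤ 3 * T * W := by nlinarith
  have h2 : (2 * (C * W) + Λ) * W ≤ 3 * T * W ^ 2 := by
    calc _ ≤ 3 * T * W * W := by gcongr
      _ = _ := by ring
  have h3 : 30 * T ^ 2 * W ^ 2 ≤ W ^ 3 := by
    calc _ ≤ W * W ^ 2 := by gcongr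
      _ = _ := by ring
  have h4 : T * W ^ 2 ≤ T ^ 2 * W ^ 2 := by gcongr
  have h5 : (2 * (C * W) + Λ) * W * (Λ + 1) ≤ 3 * T * W ^ 2 * T := by gcongr
  have h6 : C * W * Λ ≤ T * W ^ 2 * T := by gcongr; linarith
  have h7 : C * W ≤ T * W ^ 2 := by gcongr
  have h8 : Λ ≤ T * W ^ 2 := by nlinarith
  have h9 : 0 ≤ T ^ 2 * W ^ 2 := by positivity
  constructor <;> nlinarith

open Classical in
lemma exists_sphere_code {ε : ℝ} (hε : 0 < ε) {η : ℝ} (hη : 8 * √ε < η) (hη1 : η < 1) {K : ℝ} :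
    ∃ n₀ : ℕ, ∀ n : ℕ, n₀ ≤ n → ∀ R : ℝ, 2 * ε ≤ R → R ≤ K →
    ∀ M : ℕ, (M : ℝ) = (2 : ℝ) ^ (n * R) →
    ∃ a : ℕ → Metric.sphere (0 : EuclideanSpace ℝ (Fin n)) 1,
      (∀ c : EuclideanSpace ℝ (Fin n), ‖c‖ = 1 → ∀ θ, 0 ≤ θ → θ ≤ 1 → ∀ ρ, (2 : ℝ) ^ (-R) ≤ ρ →
        1 - θ ^ 2 ≤ ρ ^ 2 →
        (((Finset.range M).filter fun k ↦
          θ ≤ |⟪(a k : EuclideanSpace ℝ (Fin n)), c⟫|).card : ℝ) ≤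
            2 ^ (n * ε) * (M * ρ ^ n)) ∧
      (∀ c : EuclideanSpace ℝ (Fin n), ‖c‖ = 1 → ∀ θ ζ, η ≤ θ → θ ≤ 1 → 0 ≤ ζ → ζ ≤ 1 →
        1 + η - (2 : ℝ) ^ (-(2 * R)) < θ ^ 2 + ζ ^ 2 →
        (((Finset.range M).filter fun i ↦ ∃ j ∈ Finset.range M, j ≠ i ∧
          θ ≤ |⟪(a j : EuclideanSpace ℝ (Fin n)), (a i : EuclideanSpace ℝ (Fin n))⟫| ∧
          ζ ≤ |⟪(a j : EuclideanSpace ℝ (Fin n)), c⟫|).card : ℝ) ≤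
            M * 2 ^ (-n * ε)) := by
  set w : ℝ := 2 ^ (ε / 4) with hw
  set e : ℝ := 2 ^ (-(2 * ε)) with he_def
  set y : ℝ := 2 ^ (-K) with hy
  have hw1 : 1 < w := Real.one_lt_rpow one_lt_two (by positivity)
  have hy0 : 0 < y := by positivity
  have he0 : 0 < e := by positivity
  have he1 : e ≤ 1 := Real.rpow_le_one_of_one_le_of_nonpos one_le_two (by linarith)
  have he : 1 - 4 * ε ≤ e ^ 2 := by
    rw [he_def, ← Real.rpow_mul_natCast two_pos.le, Real.rpow_def_of_pos two_pos]
    have h1 := Real.add_one_le_exp (Real.log 2 * (-(2 * ε) * (2 : ℕ)))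
    have h2 := Real.log_two_lt_d9
    push_cast at h1 ⊢
    nlinarith
  have hd1 : w⁻¹ ^ 2 < 1 := pow_lt_one₀ (by positivity) (inv_lt_one_of_one_lt₀ hw1) two_ne_zero
  have hsd : √(1 - (1 - w⁻¹ ^ 2)) = w⁻¹ := by
    rw [sub_sub_cancel, Real.sqrt_sq (by positivity)]
  obtain ⟨L, hL⟩ := exists_nat_gt (max (16 / √ε) (4 / (y ^ 2 * (w ^ 2 - 1))))
  have hw2 : 0 < w ^ 2 - 1 := by nlinarith
  have hsε : 0 < √ε := Real.sqrt_pos.2 hε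
  have hL1 := (le_max_left _ _).trans hL.le
  have hL2 := (le_max_right _ _).trans hL.le
  have hL0 : (0 : ℝ) < L := lt_of_lt_of_le (by positivity) hL1
  set C : ℝ := (√(1 - w⁻¹ ^ 2) * (y * e))⁻¹ with hC
  have hd0 : 0 < 1 - w⁻¹ ^ 2 := by linarith
  have hC0 : 0 < C := by
    have := Real.sqrt_pos.2 hd0
    positivity
  obtain ⟨n₀, hn₀⟩ := Filter.eventually_atTop.1
    ((eventually_sq_quadratic_le_pow (A := C + 4 * (L + 1) ^ 2 + 1) (B := 2 * L) (by positivity)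
      (by positivity) hw1).and (Filter.eventually_gt_atTop 0))
  refine ⟨n₀, fun n hn R hR hRK M hM ↦ ?_⟩
  obtain ⟨hpoly, hn0⟩ := hn₀ n hn
  obtain ⟨μ, hμp, hμ⟩ := exists_measure_sphere_cap_le hn0
  obtain ⟨s, hs1, hs2, hs3⟩ := exists_finset_sphere_net n (L := L) (by exact_mod_cast hL0)
  set Λ : ℝ := 4 * (L + 1) ^ 2 + 2 * L * n ^ 2 with hΛ
  have hΛ0 : 0 ≤ Λ := by positivity
  obtain ⟨hb1, hb2⟩ := counting_constants_le hC0.le hΛ0 (W := w ^ n)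
    (by convert hpoly using 3; rw [hΛ]; ring)
  have hW : (w ^ n) ^ 4 = 2 ^ (n * ε) := by
    rw [← pow_mul, hw, ← Real.rpow_mul_natCast two_pos.le]
    congr 1
    push_cast
    ring
  rw [hW] at hb1 hb2
  set z : ℝ := 2 ^ (-R) with hz
  have hyz : y ≤ z := Real.rpow_le_rpow_of_exponent_le one_le_two (by linarith)
  have hz2 : (2 : ℝ) ^ (-(2 * R)) = z ^ 2 := by
    rw [hz, ← Real.rpow_mul_natCast two_pos.le]
    congr 1
    push_cast
    ring
  have hen : e ^ n * 2 ^ (n * ε) = 2 ^ (-n * ε) := by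
    rw [he_def, ← Real.rpow_mul_natCast two_pos.le, ← Real.rpow_add two_pos]
    congr 1
    ring
  obtain ⟨a, ha1, ha2⟩ := exists_code_of_bounds (n := n) (M := M) (L := L) (ε := ε) (η := η)
    (z := z) (e := e) (σ := w) (D := C * w ^ n) (Λ := Λ) (by exact_mod_cast hL0) (by positivity)
    (Real.rpow_le_rpow_of_exponent_le one_le_two (by linarith)) he1 he hε hη hη1
    (by
      rw [div_le_iff₀ hsε] at hL1
      rw [div_le_iff₀ hL0]
      linarith)
    (by
      rw [hM, hz, ← Real.rpow_mul_natCast two_pos.le, ← Real.rpow_add two_pos]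
      ring_nf
      exact Real.rpow_zero 2)
    (by positivity)
    (by
      rw [div_le_iff₀ (by positivity)] at hL2
      have : 4 / (L * z ^ 2) ≤ w ^ 2 - 1 := by
        rw [div_le_iff₀ (by positivity)]
        calc 4 ≤ L * (y ^ 2 * (w ^ 2 - 1)) := hL2
          _ = (w ^ 2 - 1) * (L * y ^ 2) := by ring
          _ ≤ _ := by gcongr
      linarith)
    (by positivity) hΛ0 μ (f := Subtype.val) measurable_subtype_coe
    (fun x ↦ mem_sphere_zero_iff_norm.1 x.2)
    (by
      intro c hc t r ht hr hr1 htr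
      have hr' : y * e ≤ r := le_trans (by gcongr) hr
      have hr0 : 0 < r := lt_of_lt_of_le (by positivity) hr'
      have hsd0 := Real.sqrt_pos.2 hd0
      refine (hμ c hc t r (1 - w⁻¹ ^ 2) ht hr0 hr1 hd0 (by simp; positivity) htr).trans ?_
      rw [hsd, div_inv_eq_mul, mul_pow, mul_comm (r ^ n), ← mul_assoc, hC]
      gcongr)
    s hs1 hs2 (log_card_le hs3)
  refine ⟨a, fun c hc θ hθ0 hθ1 ρ hρ hθρ ↦ ?_, fun c hc θ ζ hηθ hθ1 hζ0 hζ1 h ↦ ?_⟩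
  · refine (ha1 c hc θ hθ0 hθ1 ρ hρ hθρ).trans ?_
    have : 0 < ρ := lt_of_lt_of_le (by positivity) hρ
    gcongr
  · refine (ha2 c hc θ ζ hηθ hθ1 hζ0 hζ1 (by rwa [← hz2])).trans ?_
    calc _ ≤ M * e ^ n * 2 ^ (n * ε) := mul_le_mul_of_nonneg_left hb2 (by positivity)
      _ = _ := by rw [← hen, mul_assoc]

lemma ncard_setOf_fin_eq (M : ℕ) (p : ℕ → Prop) [DecidablePred p] :
    {m : Fin M | p m}.ncard = ((Finset.range M).filter p).card := by
  rw [← Set.ncard_image_of_injective _ Fin.val_injective, ← Set.ncard_coe_finset]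
  congr 1
  ext k
  simp only [Set.mem_image, Set.mem_ofPred_eq, Finset.coe_filter, Finset.mem_range]
  exact ⟨fun ⟨m, hm, h⟩ ↦ h ▸ ⟨m.2, hm⟩, fun ⟨h, hk⟩ ↦ ⟨⟨k, h⟩, hk, rfl⟩⟩

lemma two_rpow_mul_max_pow_le {n : ℕ} {R x : ℝ} (hx : 0 < x) :
    (2 : ℝ) ^ (n * R) * max (2 ^ (-R)) (√x) ^ n ≤
      2 ^ (n * max 0 (R + 1 / 2 * Real.logb 2 x)) := by
  have h : max ((2 : ℝ) ^ (-R)) (√x) = 2 ^ max (-R) (1 / 2 * Real.logb 2 x) := by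
    have hs : √x = 2 ^ (1 / 2 * Real.logb 2 x) := by
      rw [mul_comm, Real.rpow_mul two_pos.le, Real.rpow_logb two_pos (by norm_num) hx,
        Real.sqrt_eq_rpow]
    rw [hs, (Real.monotone_rpow_of_base_ge_one one_le_two).map_max]
  rw [h, ← Real.rpow_mul_natCast two_pos.le, ← Real.rpow_add two_pos]
  refine Real.rpow_le_rpow_of_exponent_le one_le_two (le_of_eq ?_)
  rw [mul_comm (max _ _), ← mul_add, ← max_add_add_left, add_neg_cancel]

end

/-- Csiszár–Narayan codeword construction lemma (Lemma 1 of Csiszár–Narayan 1991):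
for every `ε > 0`, `8√ε < η < 1`, `K > 2ε` there is `n₀` such that for every `n ≥ n₀`
and every rate `R` with `2ε ≤ R ≤ K` for which `M = 2^{nR}` is an integer, there are
`M` unit vectors `a(1),…,a(M)` in `ℝⁿ` such that for every unit vector `c` and all
`θ, ζ ∈ [0,1]`:
(i) `|{m̃ : ⟨a(m̃),c⟩ ≥ θ}| ≤ 2^{n([R + ½log₂(1-θ²)]₊ + ε)}` (read as `2^{nε}` when
`θ = 1`, since `½log₂ 0 = -∞`); and
(ii) if `θ ≥ η` and `θ² + ζ² > 1 + η − 2^{−2R}`, then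
`|{m : ∃ m̃ ≠ m, |⟨a(m̃),a(m)⟩| ≥ θ and |⟨a(m̃),c⟩| ≥ ζ}| ≤ M·2^{−nε}`. -/
theorem csiszar_narayan_lemma :
    ∀ ε : ℝ, 0 < ε → ∀ η : ℝ, 8 * Real.sqrt ε < η → η < 1 → ∀ K : ℝ, 2 * ε < K →
    ∃ n₀ : ℕ, ∀ n : ℕ, n₀ ≤ n → ∀ R : ℝ, 2 * ε ≤ R → R ≤ K →
    ∀ M : ℕ, (M : ℝ) = (2 : ℝ) ^ ((n : ℝ) * R) →
    ∃ a : Fin M → EuclideanSpace ℝ (Fin n),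
      (∀ m, ‖a m‖ = 1) ∧
      ∀ c : EuclideanSpace ℝ (Fin n), ‖c‖ = 1 →
        ∀ θ ∈ Set.Icc (0 : ℝ) 1, ∀ ζ ∈ Set.Icc (0 : ℝ) 1,
          (({m' : Fin M | θ ≤ ⟪a m', c⟫}.ncard : ℝ) ≤
            (if θ = 1 then (2 : ℝ) ^ ((n : ℝ) * ε)
             else (2 : ℝ) ^ ((n : ℝ) *
               (max 0 (R + (1 / 2) * Real.logb 2 (1 - θ ^ 2)) + ε)))) ∧
          (η ≤ θ → 1 + η - (2 : ℝ) ^ (-(2 * R)) < θ ^ 2 + ζ ^ 2 →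
            (({m : Fin M | ∃ m' : Fin M, m' ≠ m ∧
                θ ≤ |⟪a m', a m⟫| ∧ ζ ≤ |⟪a m', c⟫|}.ncard : ℝ) ≤
              (M : ℝ) * (2 : ℝ) ^ (-(n : ℝ) * ε))) := by
  classical
  intro ε hε η hη hη1 K _
  obtain ⟨n₀, hn₀⟩ := exists_sphere_code hε hη hη1 (K := K)
  refine ⟨n₀, fun n hn R hR hRK M hM ↦ ?_⟩
  obtain ⟨a, ha1, ha2⟩ := hn₀ n hn R hR hRK M hM
  refine ⟨fun m ↦ a m, fun m ↦ mem_sphere_zero_iff_norm.1 (a m).2, ?_⟩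
  rintro c hc θ ⟨hθ0, hθ1⟩ ζ ⟨hζ0, hζ1⟩
  refine ⟨?_, fun hηθ h ↦ ?_⟩
  · have key (ρ : ℝ) (hρ : (2 : ℝ) ^ (-R) ≤ ρ) (hθρ : 1 - θ ^ 2 ≤ ρ ^ 2) :
        ({m' : Fin M | θ ≤ ⟪(a m' : EuclideanSpace ℝ (Fin n)), c⟫}.ncard : ℝ) ≤
          2 ^ (n * ε) * (M * ρ ^ n) := by
      refine le_trans (Nat.cast_le.2 ?_) (ha1 c hc θ hθ0 hθ1 ρ hρ hθρ)
      rw [← ncard_setOf_fin_eq]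
      refine Set.ncard_le_ncard fun m hm ↦ ?_
      show θ ≤ |⟪(a m : EuclideanSpace ℝ (Fin n)), c⟫|
      exact le_trans hm (le_abs_self _)
    split_ifs with hθ
    · refine (key _ le_rfl (by rw [hθ]; simp; positivity)).trans (le_of_eq ?_)
      rw [hM, ← Real.rpow_mul_natCast two_pos.le, ← Real.rpow_add two_pos,
        show (n : ℝ) * R + -R * n = 0 by ring, Real.rpow_zero, mul_one]
    · have hθ2 : 0 < 1 - θ ^ 2 := by
        have := lt_of_le_of_ne hθ1 hθ
        nlinarith
      refine (key (max (2 ^ (-R)) √(1 - θ ^ 2)) (le_max_left _ _) ?_).trans ?_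
      · calc _ = √(1 - θ ^ 2) ^ 2 := (Real.sq_sqrt hθ2.le).symm
          _ ≤ _ := pow_le_pow_left₀ (Real.sqrt_nonneg _) (le_max_right _ _) 2
      · rw [hM, mul_add, Real.rpow_add two_pos, mul_comm]
        gcongr
        exact two_rpow_mul_max_pow_le hθ2
  · refine le_trans (le_of_eq ?_) (ha2 c hc θ ζ hηθ hθ1 hζ0 hζ1 h)
    rw [← ncard_setOf_fin_eq]
    congr 2
    ext m
    constructor
    · rintro ⟨m', hm', h'⟩
      exact ⟨m', Finset.mem_range.2 m'.2, Fin.val_ne_of_ne hm', h'⟩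
    · rintro ⟨j, hj, hjm, h'⟩
      exact ⟨⟨j, Finset.mem_range.1 hj⟩, fun h ↦ hjm (congrArg Fin.val h), h'⟩
end
end

section
/- Ahlswede's robustification technique: let S be a finite set, n a positive integer, and h : S^n → [0,1]. Suppose that for some α_n ∈ (0,1), Σ_{s^n ∈ S^n} (∏_{i=1}^n q(s_i)) h(s^n) ≤ α_n holds for every probability distribution q on S. Then for every s^n ∈ S^n, (1/n!) Σ_{π ∈ Π_n} h(π s^n) ≤ (n+1)^{|S|} α_n, where Π_n is the set of all permutations of the n coordinates and π s^n = (s_{π⁻¹(1)}, ..., s_{π⁻¹(n)}) denotes the permuted sequence. -/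
open scoped BigOperators

noncomputable section

/-- `p` is a probability mass function on a finite type. -/
def IsPMF {α : Type*} [Fintype α] (p : α → ℝ) : Prop :=
  (∀ a, 0 ≤ p a) ∧ ∑ a, p a = 1

theorem Nat.pow_mul_factorial_le (k j : ℕ) :
    k ^ j * k.factorial ≤ k ^ k * j.factorial := by
  rcases le_total k j with hkj | hjk
  · calc k ^ j * k.factorial = k ^ k * (k.factorial * k ^ (j - k)) := by
          rw [mul_left_comm, ← pow_add, Nat.add_sub_cancel' hkj, mul_comm]
      _ ≤ k ^ k * j.factorial := by
          gcongr
          exact Nat.factorial_mul_pow_sub_le_factorial hkj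
  · calc k ^ j * k.factorial ≤ k ^ j * (j.factorial * k ^ (k - j)) := by
          gcongr
          rw [← Nat.factorial_mul_descFactorial (Nat.sub_le k j), Nat.sub_sub_self hjk]
          gcongr
          exact Nat.descFactorial_le_pow k (k - j)
      _ = k ^ k * j.factorial := by
          rw [mul_left_comm, ← pow_add, Nat.add_sub_cancel' hjk, mul_comm]

open Finset in
theorem multinomial_mul_prod_pow_le {S : Type*} [Fintype S] {k j : S → ℕ}
    (hkj : ∑ a, j a = ∑ a, k a) :
    Nat.multinomial univ j * ∏ a, k a ^ j a ≤ Nat.multinomial univ k * ∏ a, k a ^ k a := by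
  have hj := Nat.multinomial_spec univ j
  have hk := Nat.multinomial_spec univ k
  rw [hkj, ← hk] at hj
  have hprod : (∏ a, k a ^ j a) * ∏ a, (k a).factorial
      ≤ (∏ a, k a ^ k a) * ∏ a, (j a).factorial := by
    simp only [← prod_mul_distrib]
    exact prod_le_prod' fun a _ => Nat.pow_mul_factorial_le (k a) (j a)
  have hpos : 0 < ∏ a, (j a).factorial := prod_pos fun a _ => Nat.factorial_pos _
  refine Nat.le_of_mul_le_mul_left ?_ hpos
  calc (∏ a, (j a).factorial) * (Nat.multinomial univ j * ∏ a, k a ^ j a)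
      = Nat.multinomial univ k * ((∏ a, k a ^ j a) * ∏ a, (k a).factorial) := by
        rw [← mul_assoc, hj]; ring
    _ ≤ Nat.multinomial univ k * ((∏ a, k a ^ k a) * ∏ a, (j a).factorial) := by gcongr
    _ = _ := by ring

open Finset in
theorem sum_pow_sum_le_multinomial {S : Type*} [Fintype S] (k : S → ℕ) :
    (∑ a, k a) ^ (∑ a, k a) ≤ (∑ a, k a + 1) ^ Fintype.card S *
      (Nat.multinomial univ k * ∏ a, k a ^ k a) := by
  classical
  set n := ∑ a, k a with hn
  rw [sum_pow_eq_sum_piAntidiag]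
  have hcard : #(piAntidiag (univ : Finset S) n) ≤ (n + 1) ^ Fintype.card S := by
    calc #(piAntidiag (univ : Finset S) n)
        ≤ #(Fintype.piFinset fun _ : S => range (n + 1)) := by
          refine card_le_card fun j hj => ?_
          rw [mem_piAntidiag] at hj
          refine Fintype.mem_piFinset.2 fun a => mem_range.2 (Nat.lt_succ_of_le ?_)
          exact hj.1 ▸ single_le_sum (fun _ _ => Nat.zero_le _) (mem_univ a)
      _ = (n + 1) ^ Fintype.card S := by simp
  refine (sum_le_card_nsmul _ _ _ fun j hj => ?_).trans (Nat.mul_le_mul_right _ hcard)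
  simpa using multinomial_mul_prod_pow_le ((mem_piAntidiag.1 hj).1.trans hn)

open Finset in
theorem card_perm_comp_symm_eq_le {α S : Type*} [Fintype α] [DecidableEq α] [Fintype S]
    [DecidableEq S] (s t : α → S) :
    #{π : Equiv.Perm α | (fun i => s (π.symm i)) = t} ≤ ∏ a, (#{i | s i = a}).factorial := by
  rcases Finset.eq_empty_or_nonempty {π : Equiv.Perm α | (fun i => s (π.symm i)) = t} with
    hE | ⟨ρ, hρ⟩
  · simp [hE]
  · simp only [mem_filter, mem_univ, true_and] at hρ
    have hstab := DomMulAct.stabilizer_card s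
    simp only [Fintype.card_subtype] at hstab
    rw [← hstab]
    refine card_le_card_of_injOn (fun π => π⁻¹ * ρ) (fun π hπ => ?_) (fun π _ π' _ hππ' => ?_)
    · simp only [coe_filter, mem_univ, true_and, Set.mem_ofPred_eq] at hπ ⊢
      funext i
      simpa using congrFun (hπ.trans hρ.symm) (ρ i)
    · simpa using hππ'

/-- Ahlswede's robustification technique: if `h : Sⁿ → [0,1]` has expectation at most
`α_n` under every i.i.d. state distribution, then for every fixed state sequence the
average of `h` over all coordinate permutations is at most `(n+1)^{|S|} α_n`. -/
theorem ahlswede_robustification {S : Type*} [Fintype S] (n : ℕ) (hn : 0 < n)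
    (h : (Fin n → S) → ℝ) (hh0 : ∀ s, 0 ≤ h s) (hh1 : ∀ s, h s ≤ 1)
    (αn : ℝ) (hα0 : 0 < αn) (hα1 : αn < 1)
    (hyp : ∀ q : S → ℝ, IsPMF q →
      (∑ s : Fin n → S, (∏ i, q (s i)) * h s) ≤ αn) :
    ∀ s : Fin n → S,
      ((n.factorial : ℝ))⁻¹ * (∑ π : Equiv.Perm (Fin n), h (fun i => s (π.symm i)))
        ≤ ((n : ℝ) + 1) ^ (Fintype.card S) * αn := by
  classical
  intro s
  set k : S → ℕ := fun a => (Finset.univ.filter fun i => s i = a).card with hk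
  have hksum : ∑ a, k a = n := by
    simpa using (Finset.card_eq_sum_card_fiberwise (s := Finset.univ) (t := Finset.univ)
      (f := s) (by simp)).symm
  have hprod (q : S → ℝ) : ∏ i, q (s i) = ∏ a, q a ^ k a := by
    rw [Finset.prod_comp q s]
    refine Finset.prod_subset (Finset.subset_univ _) fun a _ ha => ?_
    rw [Finset.card_eq_zero.2, pow_zero]
    simpa [Finset.filter_eq_empty_iff] using ha
  have hn' : (0 : ℝ) < n := by exact_mod_cast hn
  set q : S → ℝ := fun a => k a / n with hq
  have hqpmf : IsPMF q := by
    refine ⟨fun a => by positivity, ?_⟩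
    rw [← Finset.sum_div, ← Nat.cast_sum, hksum, div_self hn'.ne']
  set P : ℝ := ∏ a, q a ^ k a with hP
  have hP0 : 0 ≤ P := Finset.prod_nonneg fun a _ => pow_nonneg (hqpmf.1 a) _
  set F : ℝ := ∏ a, ((k a).factorial : ℝ) with hF
  set T := Finset.univ.image fun (π : Equiv.Perm (Fin n)) i => s (π.symm i) with hT
  have hPT : P * ∑ t ∈ T, h t ≤ αn := by
    refine le_trans ?_ (hyp q hqpmf)
    rw [Finset.mul_sum]
    refine (Finset.sum_le_sum fun t ht => ?_).trans
      (Finset.sum_le_sum_of_subset_of_nonneg (Finset.subset_univ T) fun t _ _ =>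
        mul_nonneg (Finset.prod_nonneg fun i _ => hqpmf.1 _) (hh0 t))
    obtain ⟨π, -, rfl⟩ := Finset.mem_image.1 ht
    rw [Equiv.prod_comp π.symm fun i => q (s i), hprod q]
  have hperm : ∑ π : Equiv.Perm (Fin n), h (fun i => s (π.symm i)) ≤ F * ∑ t ∈ T, h t := by
    rw [Finset.sum_comp h fun (π : Equiv.Perm (Fin n)) i => s (π.symm i), Finset.mul_sum]
    refine Finset.sum_le_sum fun t _ => ?_
    rw [nsmul_eq_mul]
    refine mul_le_mul_of_nonneg_right ?_ (hh0 t)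
    rw [hF]
    exact_mod_cast card_perm_comp_symm_eq_le s t
  have htype : F ≤ n.factorial * (((n : ℝ) + 1) ^ Fintype.card S * P) := by
    have hmain : (n : ℝ) ^ n ≤ ((n : ℝ) + 1) ^ Fintype.card S *
        (Nat.multinomial Finset.univ k * ∏ a, (k a : ℝ) ^ k a) := by
      have := sum_pow_sum_le_multinomial k
      rw [hksum] at this
      exact_mod_cast this
    have hspec : F * Nat.multinomial Finset.univ k = n.factorial := by
      have := Nat.multinomial_spec Finset.univ k
      rw [hksum] at this
      rw [hF]
      exact_mod_cast this
    have hPeq : P * (n : ℝ) ^ n = ∏ a, (k a : ℝ) ^ k a := by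
      rw [hP, ← hksum, ← Finset.prod_pow_eq_pow_sum, hksum, ← Finset.prod_mul_distrib]
      refine Finset.prod_congr rfl fun a _ => ?_
      rw [← mul_pow, hq, div_mul_cancel₀ _ hn'.ne']
    have hF0 : 0 ≤ F := Finset.prod_nonneg fun a _ => by positivity
    refine le_of_mul_le_mul_right ?_ (pow_pos hn' n)
    rw [← hspec]
    calc F * (n : ℝ) ^ n ≤ F * _ := mul_le_mul_of_nonneg_left hmain hF0
      _ = _ := by rw [← hPeq]; ring
  have hT0 : 0 ≤ ∑ t ∈ T, h t := Finset.sum_nonneg fun t _ => hh0 t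
  rw [inv_mul_le_iff₀ (by positivity)]
  calc _ ≤ F * ∑ t ∈ T, h t := hperm
    _ ≤ n.factorial * (((n : ℝ) + 1) ^ Fintype.card S * P) * ∑ t ∈ T, h t := by gcongr
    _ = n.factorial * (((n : ℝ) + 1) ^ Fintype.card S * (P * ∑ t ∈ T, h t)) := by ring
    _ ≤ _ := by gcongr
end
end
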